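/- There exists a constant C, depending only on n and Ω, such that for all maps u, v that are continuously differentiable up to the boundary of Ω with values in ℝ^n and every ψ ∈ C^1_c(Ω), one has |⟨Ju,ψ⟩ − ⟨Jv,ψ⟩| ≤ C ‖u−v‖_{W^{(n−1)/n,n}(Ω)} (‖u‖_{W^{(n−1)/n,n}(Ω)} + ‖v‖_{W^{(n−1)/n,n}(Ω)})^{n−1} ‖∇ψ‖_{L^∞(Ω)}. -/

import Mathlib

open MeasureTheory Metric Filter Topology

noncomputable section

abbrev Euc (n : ℕ) := EuclideanSpace ℝ (Fin n)

/-- The Jacobian matrix `∇u(x)` of a map `u : ℝⁿ → ℝⁿ`, with entries `∂_j u_i (x)`. -/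
def jacMat (n : ℕ) (u : Euc n → Euc n) (x : Euc n) : Matrix (Fin n) (Fin n) ℝ :=
  Matrix.of fun i j => fderiv ℝ u x (EuclideanSpace.single j 1) i

/-- The vector field `j u := (1/n) (cof ∇u)ᵀ u` (componentwise); note that
`(cof A)ᵀ = adjugate A`. -/
def jvec (n : ℕ) (u : Euc n → Euc n) (x : Euc n) : Fin n → ℝ :=
  fun i => (n : ℝ)⁻¹ * Matrix.mulVec (Matrix.adjugate (jacMat n u x)) (fun j => u x j) i

/-- The pointwise pairing `j u (x) · ∇ψ(x)`. -/
def jPair (n : ℕ) (u : Euc n → Euc n) (ψ : Euc n → ℝ) (x : Euc n) : ℝ :=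
  ∑ i, jvec n u x i * fderiv ℝ ψ x (EuclideanSpace.single i 1)

/-- `ψ ∈ C¹_c(Ω)`. -/
def Cc1 (n : ℕ) (Ω : Set (Euc n)) (ψ : Euc n → ℝ) : Prop :=
  ContDiff ℝ 1 ψ ∧ HasCompactSupport ψ ∧ tsupport ψ ⊆ Ω

/-- The fractional Sobolev seminorm `[u]_{W^{s,p}(Ω)}`. -/
def sobSemi (n : ℕ) (s p : ℝ) (Ω : Set (Euc n)) {F : Type*} [NormedAddCommGroup F]
    (u : Euc n → F) : ℝ :=
  (∫ x in Ω, ∫ y in Ω, ‖u x - u y‖ ^ p / dist x y ^ ((n : ℝ) + s * p)) ^ (1 / p)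

/-- The fractional Sobolev norm `‖u‖_{W^{s,p}(Ω)} = ‖u‖_{L^p(Ω)} + [u]_{W^{s,p}(Ω)}`. -/
def sobNorm (n : ℕ) (s p : ℝ) (Ω : Set (Euc n)) {F : Type*} [NormedAddCommGroup F]
    (u : Euc n → F) : ℝ :=
  (∫ x in Ω, ‖u x‖ ^ p) ^ (1 / p) + sobSemi n s p Ω u

/-- Membership `u ∈ W^{s,p}(Ω; F)`: `u ∈ L^p(Ω)` and the double integral defining
`[u]_{W^{s,p}(Ω)}^p` is finite. -/
def MemWsp (n : ℕ) (s p : ℝ) (Ω : Set (Euc n)) {F : Type*} [NormedAddCommGroup F]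
    (u : Euc n → F) : Prop :=
  AEStronglyMeasurable u (volume.restrict Ω) ∧
  Integrable (fun x => ‖u x‖ ^ p) (volume.restrict Ω) ∧
  Integrable (fun q : Euc n × Euc n => ‖u q.1 - u q.2‖ ^ p / dist q.1 q.2 ^ ((n : ℝ) + s * p))
    ((volume.restrict Ω).prod (volume.restrict Ω))

/-- `Ω` has smooth boundary: it is a sublevel set of a smooth function whose
differential does not vanish on the boundary. -/
def SmoothBoundary (n : ℕ) (Ω : Set (Euc n)) : Prop :=
  ∃ f : Euc n → ℝ, ContDiff ℝ (⊤ : ℕ∞) f ∧ Ω = f ⁻¹' Set.Iio 0 ∧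
    ∀ x ∈ frontier Ω, fderiv ℝ f x ≠ 0

/-- `u^a(x) = (u(x) - a)/|u(x) - a|`. -/
def proj (n : ℕ) (u : Euc n → Euc n) (a : Euc n) : Euc n → Euc n :=
  fun x => ‖u x - a‖⁻¹ • (u x - a)

/-- The set of Hölder quotients of `u` on `Ω`. -/
def holderSet (n : ℕ) (α : ℝ) (Ω : Set (Euc n)) {F : Type*} [NormedAddCommGroup F]
    (u : Euc n → F) : Set ℝ :=
  {r | ∃ x ∈ Ω, ∃ y ∈ Ω, x ≠ y ∧ r = ‖u x - u y‖ / dist x y ^ α}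

/-- The Hölder seminorm `[u]_{C^{0,α}(Ω)}`. -/
def holderSemi (n : ℕ) (α : ℝ) (Ω : Set (Euc n)) {F : Type*} [NormedAddCommGroup F]
    (u : Euc n → F) : ℝ :=
  sSup (holderSet n α Ω u)

/-- The Hölder norm `‖u‖_{C^{0,α}(Ω)} = sup_Ω ‖u‖ + [u]_{C^{0,α}(Ω)}`. -/
def holderNorm (n : ℕ) (α : ℝ) (Ω : Set (Euc n)) {F : Type*} [NormedAddCommGroup F]
    (u : Euc n → F) : ℝ :=
  sSup {r | ∃ x ∈ Ω, r = ‖u x‖} + holderSemi n α Ω u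

/-- the volume `ω_n` of the unit ball of `ℝⁿ`. -/
def ballVol (n : ℕ) : ℝ := (volume (ball (0 : Euc n) 1)).toReal

/-- `⟨Jv, ψ⟩ = J` for `v ∈ W^{(n-1)/n, n}(Ω; ℝⁿ)`: approximating sequences of maps which are
`C¹` up to the boundary exist, and for every such sequence the Jacobian integrals converge
to `J`. -/
def JPairing (n : ℕ) (Ω : Set (Euc n)) (v : Euc n → Euc n) (ψ : Euc n → ℝ) (J : ℝ) : Prop :=
  (∃ vk : ℕ → Euc n → Euc n, (∀ k, ContDiffOn ℝ 1 (vk k) (closure Ω)) ∧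
      Tendsto (fun k => sobNorm n (((n : ℝ) - 1) / n) n Ω (vk k - v)) atTop (𝓝 0) ∧
      Tendsto (fun k => ∫ x in Ω, (jacMat n (vk k) x).det * ψ x) atTop (𝓝 J)) ∧
  (∀ vk : ℕ → Euc n → Euc n, (∀ k, ContDiffOn ℝ 1 (vk k) (closure Ω)) →
      Tendsto (fun k => sobNorm n (((n : ℝ) - 1) / n) n Ω (vk k - v)) atTop (𝓝 0) →
      Tendsto (fun k => ∫ x in Ω, (jacMat n (vk k) x).det * ψ x) atTop (𝓝 J))

/-- The set of values `⟨Jv, ψ⟩` over test functions `ψ ∈ C¹_c(Ω)` with `|ψ| ≤ 1`;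
its supremum is the total variation `|Jv|_{TV}`. -/
def TVset (n : ℕ) (Ω : Set (Euc n)) (v : Euc n → Euc n) : Set ℝ :=
  {r | ∃ ψ : Euc n → ℝ, Cc1 n Ω ψ ∧ (∀ x, |ψ x| ≤ 1) ∧ JPairing n Ω v ψ r}

/-- `⟨Jv, ψ⟩ = -∫_Ω j v · ∇ψ` for (pointwise defined) `v`. -/
def jpairOn (n : ℕ) (Ω : Set (Euc n)) (v : Euc n → Euc n) (ψ : Euc n → ℝ) : ℝ :=
  -∫ x in Ω, jPair n v ψ x

/-- The `W^{-1,1}(Ω)` distance between two functionals on test functions: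
`sup { S ψ - T ψ : ψ ∈ C¹_c(Ω), Lip ψ ≤ 1 }`. -/
def Wm11dist (n : ℕ) (Ω : Set (Euc n)) (S T : (Euc n → ℝ) → ℝ) : ℝ :=
  sSup {r | ∃ ψ : Euc n → ℝ, Cc1 n Ω ψ ∧ LipschitzWith 1 ψ ∧ r = S ψ - T ψ}

/-- The matrix of partial derivatives of a family of scalar functions. -/
def gradMat (n : ℕ) (b : Fin n → Euc n → ℝ) (x : Euc n) : Matrix (Fin n) (Fin n) ℝ :=
  Matrix.of fun i j => fderiv ℝ (b i) x (EuclideanSpace.single j 1)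

lemma det_rows {n : ℕ} (M : Matrix (Fin n) (Fin n) ℝ) :
    M.det = ∑ σ : Equiv.Perm (Fin n), ((Equiv.Perm.sign σ : ℤ) : ℝ) * ∏ i, M i (σ i) := by
  rw [← Matrix.det_transpose, Matrix.det_apply']
  rfl

lemma det_gradMat_update {n : ℕ} (i : Fin n) (b : Fin n → Euc n → ℝ) (θ : Euc n → ℝ)
    (x : Euc n) :
    (gradMat n (Function.update b i θ) x).det =
      ∑ σ : Equiv.Perm (Fin n), ((Equiv.Perm.sign σ : ℤ) : ℝ) *
        ((∏ l ∈ Finset.univ.erase i, fderiv ℝ (b l) x (EuclideanSpace.single (σ l) 1)) *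
          fderiv ℝ θ x (EuclideanSpace.single (σ i) 1)) := by
  rw [det_rows]
  refine Finset.sum_congr rfl fun σ _ => ?_
  congr 1
  rw [← Finset.prod_erase_mul _ _ (Finset.mem_univ i)]
  congr 1
  · refine Finset.prod_congr rfl fun l hl => ?_
    have : l ≠ i := (Finset.mem_erase.1 hl).1
    simp [gradMat, Function.update_of_ne this]
  · simp [gradMat]

lemma hasFDerivAt_partial {n : ℕ} {b : Euc n → ℝ} (hb : ContDiff ℝ 2 b) (v x : Euc n) :
    HasFDerivAt (fun y => fderiv ℝ b y v) ((fderiv ℝ (fderiv ℝ b) x).flip v) x := by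
  have h : Differentiable ℝ (fderiv ℝ b) :=
    (hb.fderiv_right (m := 1) (by norm_num)).differentiable (by norm_num)
  have := (h x).hasFDerivAt.clm_apply (hasFDerivAt_const v x)
  rw [ContinuousLinearMap.comp_zero, zero_add] at this
  exact this

lemma piola {n : ℕ} (i : Fin n) (b : Fin n → Euc n → ℝ) (hb : ∀ j, ContDiff ℝ 2 (b j))
    (x : Euc n) :
    ∑ σ : Equiv.Perm (Fin n), ((Equiv.Perm.sign σ : ℤ) : ℝ) *
      fderiv ℝ (fun y => ∏ l ∈ Finset.univ.erase i,
        fderiv ℝ (b l) y (EuclideanSpace.single (σ l) 1)) x (EuclideanSpace.single (σ i) 1) = 0 := by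
  have h1 : ∀ σ : Equiv.Perm (Fin n),
      fderiv ℝ (fun y => ∏ l ∈ Finset.univ.erase i,
        fderiv ℝ (b l) y (EuclideanSpace.single (σ l) 1)) x (EuclideanSpace.single (σ i) 1) =
      ∑ m ∈ Finset.univ.erase i, (∏ l ∈ (Finset.univ.erase i).erase m,
        fderiv ℝ (b l) x (EuclideanSpace.single (σ l) 1)) *
        fderiv ℝ (fderiv ℝ (b m)) x (EuclideanSpace.single (σ i) 1)
          (EuclideanSpace.single (σ m) 1) := by
    intro σ
    have := HasFDerivAt.finsetProd (u := Finset.univ.erase i) (x := x)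
      (fun l _ => hasFDerivAt_partial (hb l) (EuclideanSpace.single (σ l) 1) x)
    rw [this.fderiv]
    simp
  simp_rw [h1, Finset.mul_sum]
  rw [Finset.sum_comm]
  refine Finset.sum_eq_zero fun m hm => ?_
  have hmi : m ≠ i := (Finset.mem_erase.1 hm).1
  set F : Equiv.Perm (Fin n) → ℝ := fun σ => ((Equiv.Perm.sign σ : ℤ) : ℝ) *
      ((∏ l ∈ (Finset.univ.erase i).erase m,
        fderiv ℝ (b l) x (EuclideanSpace.single (σ l) 1)) *
        fderiv ℝ (fderiv ℝ (b m)) x (EuclideanSpace.single (σ i) 1)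
          (EuclideanSpace.single (σ m) 1)) with hF
  change ∑ σ, F σ = 0
  have hsw : ∀ σ, F (σ * Equiv.swap i m) = - F σ := by
    intro σ
    have hs : IsSymmSndFDerivAt ℝ (b m) x :=
      (hb m).contDiffAt.isSymmSndFDerivAt (by simp)
    simp only [hF, Equiv.Perm.sign_mul, Equiv.Perm.sign_swap hmi.symm, Equiv.Perm.mul_apply,
      Equiv.swap_apply_left, Equiv.swap_apply_right]
    rw [hs (EuclideanSpace.single (σ m) 1)]
    have : ∏ l ∈ (Finset.univ.erase i).erase m,
        fderiv ℝ (b l) x (EuclideanSpace.single (σ (Equiv.swap i m l)) 1) =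
        ∏ l ∈ (Finset.univ.erase i).erase m,
        fderiv ℝ (b l) x (EuclideanSpace.single (σ l) 1) := by
      refine Finset.prod_congr rfl fun l hl => ?_
      simp only [Finset.mem_erase, Finset.mem_univ, and_true] at hl
      rw [Equiv.swap_apply_of_ne_of_ne hl.2 hl.1]
    rw [this]
    push_cast
    ring
  have h2 : ∑ σ, F σ = - ∑ σ, F σ := by
    rw [← Finset.sum_neg_distrib, ← Equiv.sum_comp (Equiv.mulRight (Equiv.swap i m)) F]
    exact Finset.sum_congr rfl fun σ _ => hsw σ
  linarith

lemma null_lagrangian {n : ℕ} (i : Fin n) (b : Fin n → Euc n → ℝ)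
    (hb : ∀ j, ContDiff ℝ 2 (b j)) (θ : Euc n → ℝ) (hθ : ContDiff ℝ 1 θ)
    (hc : HasCompactSupport θ) :
    ∫ x, (gradMat n (Function.update b i θ) x).det = 0 := by
  simp_rw [det_gradMat_update]
  set P : Equiv.Perm (Fin n) → Euc n → ℝ := fun σ x => ∏ l ∈ Finset.univ.erase i,
    fderiv ℝ (b l) x (EuclideanSpace.single (σ l) 1) with hP
  have hPC : ∀ σ, ContDiff ℝ 1 (P σ) := by
    intro σ
    refine contDiff_prod fun l _ => ?_
    exact ((hb l).fderiv_right (m := 1) (by norm_num)).clm_apply contDiff_const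
  have hθ' : Continuous (fderiv ℝ θ) := hθ.continuous_fderiv (by norm_num)
  have hPd : ∀ σ, Continuous (fderiv ℝ (P σ)) := fun σ => (hPC σ).continuous_fderiv (by norm_num)
  have i1 : ∀ (σ : Equiv.Perm (Fin n)) v, Integrable (fun x => P σ x * fderiv ℝ θ x v) := by
    intro σ v
    refine Continuous.integrable_of_hasCompactSupport ?_ ?_
    · exact (hPC σ).continuous.mul (hθ'.clm_apply continuous_const)
    · exact (hc.fderiv_apply ℝ v).mul_left
  have i2 : ∀ (σ : Equiv.Perm (Fin n)) v, Integrable (fun x => fderiv ℝ (P σ) x v * θ x) := by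
    intro σ v
    refine Continuous.integrable_of_hasCompactSupport ?_ ?_
    · exact ((hPd σ).clm_apply continuous_const).mul hθ.continuous
    · exact hc.mul_left
  have i3 : ∀ (σ : Equiv.Perm (Fin n)), Integrable (fun x => P σ x * θ x) := by
    intro σ
    refine Continuous.integrable_of_hasCompactSupport ?_ ?_
    · exact (hPC σ).continuous.mul hθ.continuous
    · exact hc.mul_left
  rw [integral_finsetSum _ (fun σ _ => (i1 σ _).const_mul _)]
  have : ∀ σ : Equiv.Perm (Fin n),
      ∫ x, ((Equiv.Perm.sign σ : ℤ) : ℝ) *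
        (P σ x * fderiv ℝ θ x (EuclideanSpace.single (σ i) 1)) =
      - ∫ x, ((Equiv.Perm.sign σ : ℤ) : ℝ) *
        (fderiv ℝ (P σ) x (EuclideanSpace.single (σ i) 1) * θ x) := by
    intro σ
    rw [integral_const_mul, integral_const_mul,
      integral_mul_fderiv_eq_neg_fderiv_mul_of_integrable (i2 σ _) (i1 σ _) (i3 σ)
      (fun x _ => (hPC σ).differentiable (by norm_num) x)
      (fun x _ => hθ.differentiable (by norm_num) x)]
    ring
  rw [Finset.sum_congr rfl (fun σ _ => this σ), Finset.sum_neg_distrib,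
    ← integral_finsetSum _ (fun σ _ => (i2 σ _).const_mul _)]
  have : ∀ x, ∑ σ : Equiv.Perm (Fin n), ((Equiv.Perm.sign σ : ℤ) : ℝ) *
        (fderiv ℝ (P σ) x (EuclideanSpace.single (σ i) 1) * θ x) = 0 := by
    intro x
    simp_rw [← mul_assoc]
    rw [← Finset.sum_mul, hP, piola i b hb x, zero_mul]
  simp [this]

lemma gradMat_update_det_mul {n : ℕ} (i : Fin n) (b : Fin n → Euc n → ℝ) {φ g : Euc n → ℝ}
    {x : Euc n} (hφ : DifferentiableAt ℝ φ x) (hg : DifferentiableAt ℝ g x) :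
    (gradMat n (Function.update b i (fun y => φ y * g y)) x).det =
      φ x * (gradMat n (Function.update b i g) x).det +
      g x * (gradMat n (Function.update b i φ) x).det := by
  simp_rw [det_gradMat_update]
  rw [Finset.mul_sum, Finset.mul_sum, ← Finset.sum_add_distrib]
  refine Finset.sum_congr rfl fun σ _ => ?_
  rw [fderiv_fun_mul hφ hg]
  simp
  ring

lemma continuous_gradMat_det {n : ℕ} (b : Fin n → Euc n → ℝ)
    (hb : ∀ j, ContDiff ℝ 1 (b j)) : Continuous fun x => (gradMat n b x).det := by
  refine Continuous.matrix_det ?_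
  refine continuous_matrix fun i j => ?_
  exact ((hb i).continuous_fderiv (by norm_num)).clm_apply continuous_const

lemma ibp_det {n : ℕ} (i : Fin n) (b : Fin n → Euc n → ℝ)
    (hb : ∀ j, ContDiff ℝ 2 (b j)) {φ g : Euc n → ℝ} (hφ : ContDiff ℝ 1 φ) (hg : ContDiff ℝ 1 g)
    (hc : HasCompactSupport φ) :
    ∫ x, φ x * (gradMat n (Function.update b i g) x).det =
      - ∫ x, g x * (gradMat n (Function.update b i φ) x).det := by
  have h0 := null_lagrangian i b hb (fun y => φ y * g y) (hφ.mul hg) hc.mul_right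
  have hu : ∀ {f : Euc n → ℝ}, ContDiff ℝ 1 f → ∀ j, ContDiff ℝ 1 (Function.update b i f j) := by
    intro f hf j
    by_cases h : j = i
    · subst h; simpa using hf
    · rw [Function.update_of_ne h]; exact (hb j).of_le (by norm_num)
  have c1 : Integrable fun x => φ x * (gradMat n (Function.update b i g) x).det := by
    refine Continuous.integrable_of_hasCompactSupport ?_ hc.mul_right
    exact hφ.continuous.mul (continuous_gradMat_det _ (hu hg))
  have c2 : Integrable fun x => g x * (gradMat n (Function.update b i φ) x).det := by
    refine Continuous.integrable_of_hasCompactSupport ?_ ?_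
    · exact hg.continuous.mul (continuous_gradMat_det _ (hu hφ))
    · refine HasCompactSupport.mul_left ?_
      refine HasCompactSupport.intro (K := tsupport φ) hc fun x hx => ?_
      rw [det_gradMat_update]
      have : fderiv ℝ φ x = 0 := by
        by_contra h
        exact hx (support_fderiv_subset ℝ h)
      simp [this]
  have : ∀ x, (gradMat n (Function.update b i (fun y => φ y * g y)) x).det =
      φ x * (gradMat n (Function.update b i g) x).det +
      g x * (gradMat n (Function.update b i φ) x).det := fun x =>
    gradMat_update_det_mul i b (hφ.differentiable (by norm_num) x)
      (hg.differentiable (by norm_num) x)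
  simp_rw [this] at h0
  rw [integral_add c1 c2] at h0
  linarith

lemma abs_det_le {n : ℕ} (M : Matrix (Fin n) (Fin n) ℝ) (c : Fin n → ℝ)
    (h : ∀ i j, |M i j| ≤ c i) : |M.det| ≤ (n.factorial : ℝ) * ∏ i, c i := by
  rw [det_rows]
  refine (Finset.abs_sum_le_sum_abs _ _).trans ?_
  have : ∀ σ ∈ (Finset.univ : Finset (Equiv.Perm (Fin n))),
      |((Equiv.Perm.sign σ : ℤ) : ℝ) * ∏ i, M i (σ i)| ≤ ∏ i, c i := by
    intro σ _
    rw [abs_mul, Finset.abs_prod]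
    have : |((Equiv.Perm.sign σ : ℤ) : ℝ)| = 1 := by
      rcases Int.units_eq_one_or (Equiv.Perm.sign σ) with h | h <;> simp [h]
    rw [this, one_mul]
    exact Finset.prod_le_prod (fun _ _ => abs_nonneg _) fun i _ => h i _
  refine (Finset.sum_le_card_nsmul _ _ _ this).trans ?_
  simp [Finset.card_univ, Fintype.card_perm]


/-- A fixed smooth mollifier, supported in the ball of radius `1/2`. -/
def rho (n : ℕ) : Euc n → ℝ :=
  (⟨1 / 4, 1 / 2, by norm_num, by norm_num⟩ : ContDiffBump (0 : Euc n)).normed volume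

/-- The mollification kernel at scale `t`. -/
def mker (n : ℕ) (t : ℝ) (y : Euc n) : ℝ := (t ^ n)⁻¹ * rho n (t⁻¹ • y)

/-- The kernel as a function of the pair. -/
def ker2 (n : ℕ) (q : ℝ × Euc n) : ℝ := mker n q.1 q.2

/-- Mollification at scale `q.1`, at the point `q.2`. -/
def moll (n : ℕ) (f : Euc n → ℝ) (q : ℝ × Euc n) : ℝ :=
  convolution f (mker n q.1) (ContinuousLinearMap.lsmul ℝ ℝ) volume q.2

lemma rho_contDiff (n : ℕ) {m : ℕ∞} : ContDiff ℝ m (rho n) := ContDiffBump.contDiff_normed _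

lemma rho_zero {n : ℕ} {y : Euc n} (hy : 1 / 2 ≤ ‖y‖) : rho n y = 0 := by
  by_contra h
  have : y ∈ Function.support (rho n) := h
  rw [rho, ContDiffBump.support_normed_eq] at this
  simp only [mem_ball, dist_zero_right] at this
  linarith

lemma rho_integral (n : ℕ) : ∫ y, rho n y = 1 := ContDiffBump.integral_normed _

lemma ker_zero {n : ℕ} {t : ℝ} (ht : 0 < t) {y : Euc n} (hy : t / 2 ≤ ‖y‖) : mker n t y = 0 := by
  rw [mker, rho_zero, mul_zero]
  rw [norm_smul, norm_inv, Real.norm_of_nonneg ht.le, inv_mul_eq_div, le_div_iff₀ ht]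
  linarith

lemma ker_integral {n : ℕ} {t : ℝ} (ht : 0 < t) : ∫ y, mker n t y = 1 := by
  simp only [mker]
  rw [integral_const_mul, Measure.integral_comp_inv_smul, rho_integral]
  simp [abs_of_pos ht, ht.ne']

lemma ker2_contDiffOn (n : ℕ) {m : ℕ∞} : ContDiffOn ℝ m (ker2 n) (Set.Ioi 0 ×ˢ Set.univ) := by
  have h1 : ∀ q ∈ (Set.Ioi (0 : ℝ) ×ˢ (Set.univ : Set (Euc n))), q.1 ≠ 0 := fun q hq => by
    have : 0 < q.1 := hq.1
    exact this.ne'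
  have hf : ContDiffOn ℝ m (fun q : ℝ × Euc n => q.1) (Set.Ioi 0 ×ˢ Set.univ) :=
    contDiff_fst.contDiffOn
  unfold ker2 mker
  refine ContDiffOn.mul ?_ ?_
  · exact (hf.pow n).inv fun q hq => pow_ne_zero _ (h1 q hq)
  · exact (rho_contDiff n).comp_contDiffOn ((hf.inv h1).smul contDiff_snd.contDiffOn)

lemma ker2_homog {n : ℕ} {t : ℝ} (ht : 0 < t) (q : ℝ × Euc n) :
    ker2 n q = (t ^ n)⁻¹ * ker2 n (t⁻¹ • q) := by
  simp only [ker2, mker, Prod.smul_fst, Prod.smul_snd, smul_smul, smul_eq_mul]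
  have : (t⁻¹ * q.1)⁻¹ * t⁻¹ = q.1⁻¹ := by
    rw [mul_inv, inv_inv]; field_simp
  rw [this, ← mul_assoc]
  congr 1
  rw [mul_pow, mul_inv, inv_pow, inv_inv, ← mul_assoc, inv_mul_cancel₀ (pow_ne_zero _ ht.ne'),
    one_mul]

lemma fderiv_ker2_homog {n : ℕ} {t : ℝ} (ht : 0 < t) (y : Euc n) :
    fderiv ℝ (ker2 n) (t, y) = (t ^ (n + 1))⁻¹ • fderiv ℝ (ker2 n) (1, t⁻¹ • y) := by
  have : ker2 n = fun q => (t ^ n)⁻¹ • ker2 n (t⁻¹ • q) := by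
    ext q; exact ker2_homog ht q
  conv_lhs => rw [this]
  change fderiv ℝ ((t ^ n)⁻¹ • fun q => ker2 n (t⁻¹ • q)) (t, y) = _
  rw [fderiv_const_smul_field, Pi.smul_apply, fderiv_comp_smul, smul_smul]
  congr 2
  · rw [pow_succ, mul_inv]
  · simp [ht.ne']

lemma fderiv_ker2_zero {n : ℕ} {t : ℝ} (ht : 0 < t) {y : Euc n} (hy : t ≤ ‖y‖) :
    fderiv ℝ (ker2 n) (t, y) = 0 := by
  have h : ker2 n =ᶠ[𝓝 (t, y)] fun _ => 0 := by
    have hc : Continuous fun q : ℝ × Euc n => ‖q.2‖ - q.1 / 2 := by fun_prop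
    have h1 : ∀ᶠ q : ℝ × Euc n in 𝓝 (t, y), 0 < ‖q.2‖ - q.1 / 2 :=
      hc.continuousAt.eventually_const_lt (by simp; linarith)
    have h2 : ∀ᶠ q : ℝ × Euc n in 𝓝 (t, y), 0 < q.1 :=
      continuous_fst.continuousAt.eventually_const_lt (by simpa using ht)
    filter_upwards [h1, h2] with q hq1 hq2
    exact ker_zero hq2 (by linarith)
  rw [h.fderiv_eq]
  simp

lemma isOpen_slab (n : ℕ) : IsOpen (Set.Ioi (0 : ℝ) ×ˢ (Set.univ : Set (Euc n))) :=
  isOpen_Ioi.prod isOpen_univ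

lemma continuousOn_fderiv_ker2 (n : ℕ) :
    ContinuousOn (fderiv ℝ (ker2 n)) (Set.Ioi 0 ×ˢ Set.univ) :=
  (ker2_contDiffOn n (m := 1)).continuousOn_fderiv_of_isOpen (isOpen_slab n) (by norm_num)

lemma fderiv_ker2_bound (n : ℕ) : ∃ C : ℝ, 0 < C ∧ ∀ t : ℝ, 0 < t → ∀ y : Euc n,
    ‖fderiv ℝ (ker2 n) (t, y)‖ ≤ C * (t ^ (n + 1))⁻¹ := by
  have hcont : Continuous fun y : Euc n => fderiv ℝ (ker2 n) (1, y) :=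
    (continuousOn_fderiv_ker2 n).comp_continuous (by fun_prop) (fun y => by simp)
  obtain ⟨C, hC⟩ := (isCompact_closedBall (0 : Euc n) 1).exists_bound_of_continuousOn
    hcont.continuousOn
  refine ⟨|C| + 1, by positivity, fun t ht y => ?_⟩
  rw [fderiv_ker2_homog ht, norm_smul, Real.norm_of_nonneg (by positivity), mul_comm]
  gcongr
  by_cases h : t⁻¹ • y ∈ closedBall (0 : Euc n) 1
  · exact (hC _ h).trans ((le_abs_self C).trans (by linarith))
  · rw [fderiv_ker2_zero one_pos]
    · simp; positivity
    · simp at h; exact h.le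

lemma ker_support_aux {n : ℕ} (R : ℝ) : ∀ p : ℝ, ∀ x : Euc n, p ∈ Set.Ioo 0 R →
    x ∉ closedBall (0 : Euc n) R → mker n p x = 0 := by
  intro p x hp hx
  simp only [mem_closedBall, dist_zero_right, not_le] at hx
  exact ker_zero hp.1 (by linarith [hp.1, hp.2])

lemma ker_uncurry (n : ℕ) : (Function.HasUncurry.uncurry (mker n)) = ker2 n := by
  ext ⟨a, b⟩; rfl

lemma moll_hasFDerivAt {n : ℕ} {f : Euc n → ℝ} (hf : LocallyIntegrable f) {t : ℝ} (ht : 0 < t)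
    (x : Euc n) :
    HasFDerivAt (moll n f) (∫ z, f z • fderiv ℝ (ker2 n) (t, x - z)) (t, x) := by
  have h := hasFDerivAt_convolution_right_with_param (𝕜 := ℝ) (ContinuousLinearMap.lsmul ℝ ℝ)
    (μ := (volume : Measure (Euc n))) (g := mker n) (s := Set.Ioo 0 (t + 1))
    isOpen_Ioo (isCompact_closedBall (0 : Euc n) (t + 1)) (ker_support_aux (t + 1)) hf
    (by
      rw [ker_uncurry]
      exact (ker2_contDiffOn n (m := 1)).mono
        (Set.prod_mono Set.Ioo_subset_Ioi_self subset_rfl)) (t, x)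
    ⟨ht, by simp⟩
  rw [ker_uncurry] at h
  have e : ∫ z, f z • fderiv ℝ (ker2 n) (t, x - z) =
      convolution f (fun y => fderiv ℝ (ker2 n) (t, y))
        ((ContinuousLinearMap.lsmul ℝ ℝ).precompR (ℝ × Euc n)) volume x := by
    simp only [convolution]
    congr 1
  rw [e]
  exact h

lemma moll_contDiffOn {n : ℕ} {f : Euc n → ℝ} (hf : LocallyIntegrable f) {m : ℕ∞} :
    ContDiffOn ℝ m (moll n f) (Set.Ioi 0 ×ˢ Set.univ) := by
  rintro ⟨t, x⟩ ⟨ht, -⟩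
  have ht : 0 < t := ht
  have h := contDiffOn_convolution_right_with_param (𝕜 := ℝ) (n := m)
    (ContinuousLinearMap.lsmul ℝ ℝ)
    (μ := (volume : Measure (Euc n))) (g := mker n) (s := Set.Ioo 0 (t + 1))
    isOpen_Ioo (isCompact_closedBall (0 : Euc n) (t + 1)) (ker_support_aux (t + 1)) hf
    (by
      rw [ker_uncurry]
      exact (ker2_contDiffOn n (m := m)).mono
        (Set.prod_mono Set.Ioo_subset_Ioi_self subset_rfl))
  have hn : (Set.Ioo 0 (t + 1) ×ˢ (Set.univ : Set (Euc n))) ∈ 𝓝 (t, x) :=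
    (isOpen_Ioo.prod isOpen_univ).mem_nhds ⟨⟨ht, by simp⟩, trivial⟩
  exact (h.contDiffAt hn).contDiffWithinAt

lemma ker_integrable_aux {n : ℕ} {f : Euc n → ℝ} (hf : LocallyIntegrable f) {t : ℝ} (ht : 0 < t)
    (x : Euc n) : Integrable fun z => f z * mker n t (x - z) := by
  have hc : Continuous (mker n t) :=
    (ker2_contDiffOn n (m := 1)).continuousOn.comp_continuous (f := fun y => (t, y))
      (by fun_prop) (fun y => ⟨ht, trivial⟩)
  have hs : HasCompactSupport (mker n t) := by
    refine HasCompactSupport.intro (isCompact_closedBall (0 : Euc n) (t + 1)) fun y hy => ?_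
    exact ker_support_aux (t + 1) t y ⟨ht, by simp⟩ hy
  exact hs.convolutionExists_right (ContinuousLinearMap.lsmul ℝ ℝ) hf hc x

lemma moll_sub {n : ℕ} {f g : Euc n → ℝ} (hf : LocallyIntegrable f) (hg : LocallyIntegrable g)
    {t : ℝ} (ht : 0 < t) (x : Euc n) :
    moll n (fun z => f z - g z) (t, x) = moll n f (t, x) - moll n g (t, x) := by
  simp only [moll, convolution, ContinuousLinearMap.lsmul_apply, smul_eq_mul]
  rw [← integral_sub (ker_integrable_aux hf ht x) (ker_integrable_aux hg ht x)]
  simp_rw [sub_mul]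

lemma moll_const {n : ℕ} (c : ℝ) {t : ℝ} (ht : 0 < t) (x : Euc n) :
    moll n (fun _ => c) (t, x) = c := by
  simp only [moll, convolution, ContinuousLinearMap.lsmul_apply, smul_eq_mul]
  rw [integral_const_mul, integral_sub_left_eq_self (fun y => mker n t y), ker_integral ht, mul_one]

lemma fderiv_moll_sub {n : ℕ} {f g : Euc n → ℝ} (hf : LocallyIntegrable f)
    (hg : LocallyIntegrable g) {t : ℝ} (ht : 0 < t) (x : Euc n) :
    fderiv ℝ (moll n (fun z => f z - g z)) (t, x) =
      fderiv ℝ (moll n f) (t, x) - fderiv ℝ (moll n g) (t, x) := by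
  have : moll n (fun z => f z - g z) =ᶠ[𝓝 (t, x)] fun q => moll n f q - moll n g q := by
    filter_upwards [(isOpen_slab n).mem_nhds (show (t, x) ∈ _ from ⟨ht, trivial⟩)]
    rintro ⟨s, y⟩ ⟨hs, -⟩
    exact moll_sub hf hg hs y
  rw [this.fderiv_eq, fderiv_fun_sub (moll_hasFDerivAt hf ht x).differentiableAt
    (moll_hasFDerivAt hg ht x).differentiableAt]

lemma fderiv_moll_const {n : ℕ} (c : ℝ) {t : ℝ} (ht : 0 < t) (x : Euc n) :
    fderiv ℝ (moll n (fun _ => c)) (t, x) = 0 := by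
  have : moll n (fun _ => c) =ᶠ[𝓝 (t, x)] fun q => c := by
    filter_upwards [(isOpen_slab n).mem_nhds (show (t, x) ∈ _ from ⟨ht, trivial⟩)]
    rintro ⟨s, y⟩ ⟨hs, -⟩
    exact moll_const c hs y
  rw [this.fderiv_eq]; simp

lemma fderiv_moll_bound (n : ℕ) : ∃ C : ℝ, 0 < C ∧ ∀ (f : Euc n → ℝ), LocallyIntegrable f →
    ∀ t : ℝ, 0 < t → ∀ x : Euc n, ‖fderiv ℝ (moll n f) (t, x)‖ ≤
      C * (t ^ (n + 1))⁻¹ * ∫ z in ball x t, |f z| := by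
  obtain ⟨C, hC, hb⟩ := fderiv_ker2_bound n
  refine ⟨C, hC, fun f hf t ht x => ?_⟩
  rw [(moll_hasFDerivAt hf ht x).fderiv, ← integral_const_mul]
  rw [← integral_indicator measurableSet_ball]
  have hfi : IntegrableOn f (ball x t) :=
    (hf.integrableOn_isCompact (isCompact_closedBall x t)).mono_set ball_subset_closedBall
  refine norm_integral_le_of_norm_le ?_ (Eventually.of_forall fun z => ?_)
  · rw [integrable_indicator_iff measurableSet_ball]
    exact hfi.abs.const_mul _
  · by_cases hz : z ∈ ball x t
    · rw [Set.indicator_of_mem hz, norm_smul, Real.norm_eq_abs, mul_comm]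
      gcongr
      exact hb t ht _
    · rw [Set.indicator_of_notMem hz, fderiv_ker2_zero ht]
      · simp
      · rw [mem_ball', dist_eq_norm, not_lt] at hz
        exact hz

lemma fderiv_moll_bound_sub {n : ℕ} {C : ℝ} (hC : ∀ (f : Euc n → ℝ), LocallyIntegrable f →
    ∀ t : ℝ, 0 < t → ∀ x : Euc n, ‖fderiv ℝ (moll n f) (t, x)‖ ≤
      C * (t ^ (n + 1))⁻¹ * ∫ z in ball x t, |f z|)
    (f : Euc n → ℝ) (hf : LocallyIntegrable f) (t : ℝ) (ht : 0 < t) (x : Euc n) :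
    ‖fderiv ℝ (moll n f) (t, x)‖ ≤ C * (t ^ (n + 1))⁻¹ * ∫ z in ball x t, |f z - f x| := by
  have hc : LocallyIntegrable (fun _ : Euc n => f x) := continuous_const.locallyIntegrable
  have := hC (fun z => f z - f x) (hf.sub hc) t ht x
  rwa [fderiv_moll_sub hf hc ht x, fderiv_moll_const _ ht, sub_zero] at this

lemma fderiv_moll_linear {n : ℕ} (ℓ : Euc n →L[ℝ] ℝ) {t : ℝ} (ht : 0 < t) (x v : Euc n) :
    fderiv ℝ (moll n ℓ) (t, x) (0, v) = ℓ v := by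
  have hl : LocallyIntegrable (fun z : Euc n => ℓ z) := ℓ.continuous.locallyIntegrable
  have h1 : HasFDerivAt (fun y => moll n ℓ (t, y))
      ((fderiv ℝ (moll n ℓ) (t, x)).comp (ContinuousLinearMap.inr ℝ ℝ (Euc n))) x :=
    ((moll_hasFDerivAt hl ht x).differentiableAt.hasFDerivAt).comp x (hasFDerivAt_prodMk_right t x)
  have h2 : ∀ y, moll n ℓ (t, y) = ℓ y + moll n ℓ (t, 0) := by
    intro y
    simp only [moll, convolution, ContinuousLinearMap.lsmul_apply, smul_eq_mul]
    rw [← integral_add_right_eq_self _ y]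
    have e : ∀ z, ℓ (z + y) * mker n t (y - (z + y)) =
        ℓ y * mker n t (0 - z) + ℓ z * mker n t (0 - z) := by
      intro z
      rw [map_add, show y - (z + y) = 0 - z by abel]; ring
    simp_rw [e]
    rw [integral_add (ker_integrable_aux (f := fun _ => ℓ y)
      continuous_const.locallyIntegrable ht 0) (ker_integrable_aux hl ht 0), integral_const_mul,
      integral_sub_left_eq_self (fun y => mker n t y), ker_integral ht, mul_one]
  have h3 : HasFDerivAt (fun y => moll n ℓ (t, y)) ℓ x := by
    rw [show (fun y => moll n ℓ (t, y)) = fun y => ℓ y + moll n ℓ (t, 0) from funext h2]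
    exact ℓ.hasFDerivAt.add_const _
  have := congrArg (fun A => A v) (h1.unique h3)
  simpa using this

lemma fderiv_moll_tendsto {n : ℕ} {f : Euc n → ℝ} (hf : LocallyIntegrable f) {x : Euc n}
    (hd : DifferentiableAt ℝ f x) (v : Euc n) :
    Tendsto (fun t : ℝ => fderiv ℝ (moll n f) (t, x) (0, v)) (𝓝[>] 0) (𝓝 (fderiv ℝ f x v)) := by
  obtain ⟨C, hC, hb⟩ := fderiv_moll_bound n
  set ℓ := fderiv ℝ f x with hℓ
  have hl : LocallyIntegrable (fun z : Euc n => ℓ z) := ℓ.continuous.locallyIntegrable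
  set B := (volume (ball (0 : Euc n) 1)).toReal with hB
  have hB0 : 0 ≤ B := ENNReal.toReal_nonneg
  rw [Metric.tendsto_nhdsWithin_nhds]
  intro ε hε
  set η := ε / (2 * (C * B * (‖v‖ + 1) + 1)) with hη
  have hη0 : 0 < η := by positivity
  have h1 := hd.hasFDerivAt.isLittleO.def hη0
  obtain ⟨δ, hδ, h1⟩ := Metric.eventually_nhds_iff.1 h1
  refine ⟨δ, hδ, fun t ht htd => ?_⟩
  have ht : 0 < t := ht
  rw [dist_zero_right, Real.norm_of_nonneg ht.le] at htd
  have hcc : LocallyIntegrable (fun _ : Euc n => f x - ℓ x) := continuous_const.locallyIntegrable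
  have hfl : LocallyIntegrable (fun z => f z - ℓ z) := hf.sub hl
  have h2 := hb (fun z => (f z - ℓ z) - (f x - ℓ x)) (hfl.sub hcc) t ht x
  rw [fderiv_moll_sub hfl hcc ht, fderiv_moll_const _ ht, sub_zero] at h2
  have h3 : fderiv ℝ (moll n (fun z => f z - ℓ z)) (t, x) = _ := fderiv_moll_sub hf hl ht x
  have h4 : ∫ z in ball x t, |f z - ℓ z - (f x - ℓ x)| ≤ (η * t) * (t ^ n * B) := by
    have hv : volume.real (ball x t) = t ^ n * B := by
      rw [Measure.real, Measure.addHaar_ball_of_pos _ _ ht]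
      simp [hB, ht.le]
    rw [← hv]
    have : ‖∫ z in ball x t, |f z - ℓ z - (f x - ℓ x)|‖ ≤ (η * t) * volume.real (ball x t) := by
      refine norm_setIntegral_le_of_norm_le_const measure_ball_lt_top fun z hz => ?_
      rw [Real.norm_eq_abs, abs_abs]
      have hz' : dist z x < t := hz
      have := h1 (hz'.trans htd)
      rw [show f z - ℓ z - (f x - ℓ x) = f z - f x - ℓ (z - x) by rw [map_sub]; ring]
      refine this.trans ?_
      rw [← dist_eq_norm]
      gcongr
    exact (le_abs_self _).trans this
  have h5 : ‖fderiv ℝ (moll n (fun z => f z - ℓ z)) (t, x)‖ ≤ C * B * η := by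
    refine h2.trans ((mul_le_mul_of_nonneg_left h4 (by positivity)).trans (le_of_eq ?_))
    rw [pow_succ]
    field_simp
  have h6 : fderiv ℝ (moll n f) (t, x) (0, v) - ℓ v =
      fderiv ℝ (moll n (fun z => f z - ℓ z)) (t, x) (0, v) := by
    rw [h3, sub_apply]
    congr 1
    exact (fderiv_moll_linear ℓ ht x v).symm
  rw [dist_eq_norm, h6]
  refine (ContinuousLinearMap.le_opNorm _ _).trans_lt ?_
  have h7 : ‖((0 : ℝ), v)‖ = ‖v‖ := by simp [Prod.norm_def]
  rw [h7]
  calc _ ≤ C * B * η * ‖v‖ := by gcongr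
    _ ≤ (C * B * (‖v‖ + 1) + 1) * η := by nlinarith [mul_nonneg hC.le hB0]
    _ = ε / 2 := by rw [hη]; field_simp
    _ < ε := by linarith


lemma hasFDerivAt_slice {n : ℕ} {W : ℝ × Euc n → ℝ} {t : ℝ} {x : Euc n}
    (h : DifferentiableAt ℝ W (t, x)) :
    HasFDerivAt (fun y => W (t, y))
      ((fderiv ℝ W (t, x)).comp (ContinuousLinearMap.inr ℝ ℝ (Euc n))) x :=
  h.hasFDerivAt.comp x (hasFDerivAt_prodMk_right t x)

lemma fderiv_slice {n : ℕ} {W : ℝ × Euc n → ℝ} {t : ℝ} {x : Euc n}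
    (h : DifferentiableAt ℝ W (t, x)) (v : Euc n) :
    fderiv ℝ (fun y => W (t, y)) x v = fderiv ℝ W (t, x) (0, v) := by
  rw [(hasFDerivAt_slice h).fderiv]; simp

lemma contDiff_slice {n : ℕ} {W : ℝ × Euc n → ℝ} {m : WithTop ℕ∞}
    (h : ContDiffOn ℝ m W (Set.Ioi 0 ×ˢ Set.univ)) {t : ℝ} (ht : 0 < t) :
    ContDiff ℝ m (fun y => W (t, y)) := by
  rw [← contDiffOn_univ]
  exact h.comp (contDiff_prodMk_right t).contDiffOn (fun y _ => ⟨ht, trivial⟩)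

lemma hasDerivAt_time {n : ℕ} {F : Type*} [NormedAddCommGroup F] [NormedSpace ℝ F]
    {W : ℝ × Euc n → F} {t : ℝ} {x : Euc n}
    (h : DifferentiableAt ℝ W (t, x)) :
    HasDerivAt (fun s => W (s, x)) (fderiv ℝ W (t, x) (1, 0)) t := by
  have h2 : HasDerivAt (fun s : ℝ => (s, x)) ((1 : ℝ), (0 : Euc n)) t :=
    (hasDerivAt_id t).prodMk (hasDerivAt_const t x)
  exact h.hasFDerivAt.comp_hasDerivAt t h2

/-- The time derivative of `Ψ det ∇W`. -/
def dtH (n : ℕ) (W : Fin n → ℝ × Euc n → ℝ) (Ψ : ℝ × Euc n → ℝ) (q : ℝ × Euc n) : ℝ :=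
  fderiv ℝ Ψ q (1, 0) * (gradMat n (fun i y => W i (q.1, y)) q.2).det +
    ∑ i, Ψ q * (gradMat n (Function.update (fun i y => W i (q.1, y)) i
      (fun y => fderiv ℝ (W i) (q.1, y) (1, 0))) q.2).det

section stokes

variable {n : ℕ} {W : Fin n → ℝ × Euc n → ℝ} {Ψ : ℝ × Euc n → ℝ}

lemma slab_diff {F : Type*} [NormedAddCommGroup F] [NormedSpace ℝ F] {f : ℝ × Euc n → F}
    (h : ContDiffOn ℝ 1 f (Set.Ioi 0 ×ˢ Set.univ)) {t : ℝ} (ht : 0 < t) (x : Euc n) :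
    DifferentiableAt ℝ f (t, x) :=
  (h.differentiableOn (by norm_num)).differentiableAt
    ((isOpen_slab n).mem_nhds ⟨ht, trivial⟩)

lemma slab_fderiv {f : ℝ × Euc n → ℝ} {k m : WithTop ℕ∞} (hm : k + 1 ≤ m)
    (h : ContDiffOn ℝ m f (Set.Ioi 0 ×ˢ Set.univ)) :
    ContDiffOn ℝ k (fderiv ℝ f) (Set.Ioi 0 ×ˢ Set.univ) :=
  h.fderiv_of_isOpen (isOpen_slab n) hm

lemma hasDerivAt_entry (hW : ∀ i, ContDiffOn ℝ 3 (W i) (Set.Ioi 0 ×ˢ Set.univ))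
    {t : ℝ} (ht : 0 < t) (x v : Euc n) (i : Fin n) :
    HasDerivAt (fun s => fderiv ℝ (fun y => W i (s, y)) x v)
      (fderiv ℝ (fun y => fderiv ℝ (W i) (t, y) (1, 0)) x v) t := by
  have h2 : ContDiffOn ℝ 1 (fderiv ℝ (W i)) (Set.Ioi 0 ×ˢ Set.univ) :=
    slab_fderiv (by norm_num) (hW i)
  have hd := slab_diff h2 ht x
  have e1 : (fun s => fderiv ℝ (fun y => W i (s, y)) x v) =ᶠ[𝓝 t]
      fun s => fderiv ℝ (W i) (s, x) (0, v) := by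
    filter_upwards [Ioi_mem_nhds ht] with s hs
    exact fderiv_slice (slab_diff ((hW i).of_le (by norm_num)) hs x) v
  have e2 : HasDerivAt (fun s => fderiv ℝ (W i) (s, x) (0, v))
      (fderiv ℝ (fderiv ℝ (W i)) (t, x) (1, 0) (0, v)) t := by
    have := (hasDerivAt_time hd).clm_apply (hasDerivAt_const t ((0 : ℝ), v))
    simpa using this
  have e3 : fderiv ℝ (fun y => fderiv ℝ (W i) (t, y) (1, 0)) x v =
      fderiv ℝ (fderiv ℝ (W i)) (t, x) (0, v) (1, 0) := by
    have h4 : HasFDerivAt (fun y => fderiv ℝ (W i) (t, y))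
      ((fderiv ℝ (fderiv ℝ (W i)) (t, x)).comp (ContinuousLinearMap.inr ℝ ℝ (Euc n))) x :=
      hd.hasFDerivAt.comp x (hasFDerivAt_prodMk_right t x)
    have := h4.clm_apply (hasFDerivAt_const ((1 : ℝ), (0 : Euc n)) x)
    rw [this.fderiv]
    simp
  have hs : IsSymmSndFDerivAt ℝ (W i) (t, x) :=
    ((hW i).contDiffAt ((isOpen_slab n).mem_nhds
      (show (t, x) ∈ _ from ⟨ht, trivial⟩))).isSymmSndFDerivAt (by
      simp; norm_num)
  rw [e3, ← hs (1, 0)]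
  exact e2.congr_of_eventuallyEq e1

lemma hasDerivAt_H (hW : ∀ i, ContDiffOn ℝ 3 (W i) (Set.Ioi 0 ×ˢ Set.univ))
    (hΨ : ContDiffOn ℝ 1 Ψ (Set.Ioi 0 ×ˢ Set.univ)) {t : ℝ} (ht : 0 < t) (x : Euc n) :
    HasDerivAt (fun s => Ψ (s, x) * (gradMat n (fun i y => W i (s, y)) x).det)
      (dtH n W Ψ (t, x)) t := by
  have hdet : HasDerivAt (fun s => (gradMat n (fun i y => W i (s, y)) x).det)
      (∑ i, (gradMat n (Function.update (fun i y => W i (t, y)) i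
      (fun y => fderiv ℝ (W i) (t, y) (1, 0))) x).det) t := by
    simp_rw [det_gradMat_update]
    rw [Finset.sum_comm]
    simp_rw [det_rows]
    refine HasDerivAt.fun_sum fun σ _ => ?_
    simp_rw [← Finset.mul_sum]
    refine HasDerivAt.const_mul _ ?_
    have := HasDerivAt.fun_finsetProd (u := (Finset.univ : Finset (Fin n))) (x := t)
      (fun i _ => hasDerivAt_entry hW ht x (EuclideanSpace.single (σ i) 1) i)
    simpa [gradMat] using this
  have := (hasDerivAt_time (slab_diff hΨ ht x)).mul hdet
  rw [Finset.mul_sum] at this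
  exact this

lemma continuousOn_gradMat_slice {b : Fin n → ℝ × Euc n → ℝ}
    (hb : ∀ i, ContDiffOn ℝ 1 (b i) (Set.Ioi 0 ×ˢ Set.univ)) :
    ContinuousOn (fun q : ℝ × Euc n => (gradMat n (fun i y => b i (q.1, y)) q.2).det)
      (Set.Ioi 0 ×ˢ Set.univ) := by
  have h : ContinuousOn (fun q : ℝ × Euc n =>
      (Matrix.of fun i j => fderiv ℝ (b i) q (0, EuclideanSpace.single j 1) :
        Matrix (Fin n) (Fin n) ℝ).det) (Set.Ioi 0 ×ˢ Set.univ) := by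
    rw [continuousOn_iff_continuous_domRestrict]
    refine Continuous.matrix_det ?_
    refine continuous_matrix fun i j => ?_
    have := (hb i).continuousOn_fderiv_of_isOpen (isOpen_slab n) (by norm_num)
    rw [continuousOn_iff_continuous_domRestrict] at this
    exact this.clm_apply continuous_const
  refine h.congr ?_
  rintro ⟨t, x⟩ ⟨ht, -⟩
  simp only [gradMat]
  congr 2
  ext i j
  exact fderiv_slice (slab_diff (hb i) ht x) _

lemma contDiffOn_dt (hW : ∀ i, ContDiffOn ℝ 3 (W i) (Set.Ioi 0 ×ˢ Set.univ)) (i : Fin n) :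
    ContDiffOn ℝ 1 (fun q => fderiv ℝ (W i) q (1, 0)) (Set.Ioi 0 ×ˢ Set.univ) :=
  (slab_fderiv (k := 1) (by norm_num) (hW i)).clm_apply contDiffOn_const

lemma continuousOn_dtH (hW : ∀ i, ContDiffOn ℝ 3 (W i) (Set.Ioi 0 ×ˢ Set.univ))
    (hΨ : ContDiffOn ℝ 1 Ψ (Set.Ioi 0 ×ˢ Set.univ)) :
    ContinuousOn (dtH n W Ψ) (Set.Ioi 0 ×ˢ Set.univ) := by
  unfold dtH
  refine ContinuousOn.add ?_ (continuousOn_finsetSum _ fun i _ => ?_)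
  · refine ContinuousOn.mul ?_ (continuousOn_gradMat_slice fun i => (hW i).of_le (by norm_num))
    exact (hΨ.continuousOn_fderiv_of_isOpen (isOpen_slab n) (by norm_num)).clm_apply
      continuousOn_const
  · refine hΨ.continuousOn.mul ?_
    have := continuousOn_gradMat_slice
      (b := Function.update W i (fun q => fderiv ℝ (W i) q (1, 0))) (by
        intro j
        by_cases h : j = i
        · subst h; simpa using contDiffOn_dt hW j
        · rw [Function.update_of_ne h]; exact (hW j).of_le (by norm_num))
    refine this.congr fun q _ => ?_
    congr 2
    ext j y
    by_cases h : j = i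
    · subst h; simp
    · simp [Function.update_of_ne h]

lemma fderiv_zero_off {K : Set (Euc n)} (hK : IsCompact K)
    (hΨK : ∀ t, 0 < t → ∀ x, x ∉ K → Ψ (t, x) = 0) {t : ℝ} (ht : 0 < t) {x : Euc n}
    (hx : x ∉ K) : fderiv ℝ Ψ (t, x) = 0 := by
  have : Ψ =ᶠ[𝓝 (t, x)] fun _ => 0 := by
    have ho : IsOpen (Set.Ioi (0 : ℝ) ×ˢ Kᶜ) := isOpen_Ioi.prod hK.isClosed.isOpen_compl
    filter_upwards [ho.mem_nhds (show (t, x) ∈ _ from ⟨ht, hx⟩)]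
    rintro ⟨s, y⟩ ⟨hs, hy⟩
    exact hΨK s hs y hy
  rw [this.fderiv_eq]; simp

lemma stokes (hW : ∀ i, ContDiffOn ℝ 3 (W i) (Set.Ioi 0 ×ˢ Set.univ))
    (hΨ : ContDiffOn ℝ 1 Ψ (Set.Ioi 0 ×ˢ Set.univ)) {K : Set (Euc n)} (hK : IsCompact K)
    (hΨK : ∀ t, 0 < t → ∀ x, x ∉ K → Ψ (t, x) = 0) {T : ℝ} (hΨT : ∀ x, Ψ (T, x) = 0)
    {ε : ℝ} (hε : 0 < ε) (hεT : ε ≤ T) :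
    ∫ x, Ψ (ε, x) * (gradMat n (fun i y => W i (ε, y)) x).det =
      - ∫ t in Set.Ioc ε T, ∫ x, (fderiv ℝ Ψ (t, x) (1, 0) *
          (gradMat n (fun i y => W i (t, y)) x).det -
        ∑ i, fderiv ℝ (W i) (t, x) (1, 0) * (gradMat n (Function.update (fun i y => W i (t, y)) i
          (fun y => Ψ (t, y))) x).det) := by
  have hzero : ∀ t, 0 < t → ∀ x, x ∉ K → dtH n W Ψ (t, x) = 0 := by
    intro t ht x hx
    simp [dtH, fderiv_zero_off hK hΨK ht hx, hΨK t ht x hx]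
  have hsub : Set.Icc ε T ×ˢ (Set.univ : Set (Euc n)) ⊆ Set.Ioi 0 ×ˢ Set.univ :=
    Set.prod_mono (fun t ht => lt_of_lt_of_le hε ht.1) subset_rfl
  have hcont : ContinuousOn (dtH n W Ψ) (Set.Icc ε T ×ˢ Set.univ) :=
    (continuousOn_dtH hW hΨ).mono hsub
  have hintg : Integrable (dtH n W Ψ)
      ((volume.restrict (Set.Ioc ε T)).prod (volume : Measure (Euc n))) := by
    have h1 : IntegrableOn (dtH n W Ψ) (Set.Icc ε T ×ˢ K) (volume.prod volume) :=
      (hcont.mono (Set.prod_mono subset_rfl (Set.subset_univ _))).integrableOn_compact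
        (isCompact_Icc.prod hK)
    have h2 : IntegrableOn (dtH n W Ψ) (Set.Ioc ε T ×ˢ Set.univ) (volume.prod volume) := by
      refine h1.of_forall_sdiff_eq_zero (measurableSet_Ioc.prod MeasurableSet.univ) ?_
      rintro ⟨t, x⟩ ⟨⟨ht, -⟩, h⟩
      refine hzero t (hε.trans ht.1) x fun hx => h ⟨⟨ht.1.le, ht.2⟩, hx⟩
    rw [IntegrableOn, ← Measure.prod_restrict, Measure.restrict_univ] at h2
    exact h2
  have hftc : ∀ x, Ψ (ε, x) * (gradMat n (fun i y => W i (ε, y)) x).det =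
      - ∫ t in Set.Ioc ε T, dtH n W Ψ (t, x) := by
    intro x
    rw [← intervalIntegral.integral_of_le hεT,
      intervalIntegral.integral_eq_sub_of_hasDerivAt (f := fun s => Ψ (s, x) *
        (gradMat n (fun i y => W i (s, y)) x).det)]
    · simp [hΨT x]
    · intro t ht
      rw [Set.uIcc_of_le hεT] at ht
      exact hasDerivAt_H hW hΨ (hε.trans_le ht.1) x
    · refine ContinuousOn.intervalIntegrable ?_
      rw [Set.uIcc_of_le hεT]
      exact hcont.comp (by fun_prop) fun t ht => ⟨ht, trivial⟩
  simp_rw [hftc]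
  rw [integral_neg, integral_integral_swap (f := fun x t => dtH n W Ψ (t, x)) hintg.swap]
  congr 1
  refine setIntegral_congr_fun measurableSet_Ioc fun t ht => ?_
  have ht0 : 0 < t := hε.trans ht.1
  have hφ : ContDiff ℝ 1 (fun y => Ψ (t, y)) := contDiff_slice hΨ ht0
  have hφc : HasCompactSupport (fun y => Ψ (t, y)) :=
    HasCompactSupport.intro hK fun x hx => hΨK t ht0 x hx
  have hb : ∀ j, ContDiff ℝ 2 ((fun i y => W i (t, y)) j) := fun j =>
    (contDiff_slice (hW j) ht0).of_le (by norm_num)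
  have hg : ∀ i, ContDiff ℝ 1 (fun y => fderiv ℝ (W i) (t, y) (1, 0)) := fun i =>
    contDiff_slice (contDiffOn_dt hW i) ht0
  have hu : ∀ i, ∀ {f : Euc n → ℝ}, ContDiff ℝ 1 f → ∀ j,
      ContDiff ℝ 1 (Function.update (fun i y => W i (t, y)) i f j) := by
    intro i f hf j
    by_cases h : j = i
    · subst h; simpa using hf
    · rw [Function.update_of_ne h]; exact (hb j).of_le (by norm_num)
  have i1 : Integrable fun x => fderiv ℝ Ψ (t, x) (1, 0) *
      (gradMat n (fun i y => W i (t, y)) x).det := by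
    refine Continuous.integrable_of_hasCompactSupport ?_ ?_
    · refine Continuous.mul ?_ (continuous_gradMat_det _ fun j => (hb j).of_le (by norm_num))
      have := hΨ.continuousOn_fderiv_of_isOpen (isOpen_slab n) (by norm_num)
      exact (this.comp_continuous (f := fun y => (t, y)) (by fun_prop) (fun y => ⟨ht0, trivial⟩)).clm_apply
        continuous_const
    · refine HasCompactSupport.intro hK fun x hx => ?_
      simp [fderiv_zero_off hK hΨK ht0 hx]
  have i2 : ∀ i, Integrable fun x => Ψ (t, x) * (gradMat n (Function.update
      (fun i y => W i (t, y)) i (fun y => fderiv ℝ (W i) (t, y) (1, 0))) x).det := by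
    intro i
    refine Continuous.integrable_of_hasCompactSupport ?_ hφc.mul_right
    exact hφ.continuous.mul (continuous_gradMat_det _ (hu i (hg i)))
  have i3 : ∀ i, Integrable fun x => fderiv ℝ (W i) (t, x) (1, 0) * (gradMat n (Function.update
      (fun i y => W i (t, y)) i (fun y => Ψ (t, y))) x).det := by
    intro i
    refine Continuous.integrable_of_hasCompactSupport ?_ ?_
    · exact (hg i).continuous.mul (continuous_gradMat_det _ (hu i hφ))
    · refine HasCompactSupport.mul_left ?_
      refine HasCompactSupport.intro (K := tsupport fun y => Ψ (t, y)) hφc fun x hx => ?_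
      rw [det_gradMat_update]
      have : fderiv ℝ (fun y => Ψ (t, y)) x = 0 := by
        by_contra h
        exact hx (support_fderiv_subset ℝ h)
      simp [this]
  simp only [dtH]
  rw [integral_add i1 (integrable_finsetSum _ fun i _ => i2 i),
    integral_sub i1 (integrable_finsetSum _ fun i _ => i3 i),
    integral_finsetSum _ (fun i _ => i2 i), integral_finsetSum _ (fun i _ => i3 i),
    sub_eq_add_neg, ← Finset.sum_neg_distrib]
  congr 1
  refine Finset.sum_congr rfl fun i _ => ?_
  exact ibp_det i _ hb hφ (hg i) hφc

end stokes


/-- Truncated difference. -/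
def tdiff (n : ℕ) (f : Euc n → ℝ) (t : ℝ) (x z : Euc n) : ENNReal :=
  if dist z x < t then ‖f z - f x‖ₑ else 0

/-- Averaged oscillation quotient. -/
def gosc (n : ℕ) (Ω : Set (Euc n)) (f : Euc n → ℝ) (t : ℝ) (x : Euc n) : ENNReal :=
  ENNReal.ofReal ((t ^ (n + 1))⁻¹) * ∫⁻ z in Ω, tdiff n f t x z

/-- Gagliardo energy as a lower Lebesgue integral. -/
def gagl (n : ℕ) (Ω : Set (Euc n)) (f : Euc n → ℝ) : ENNReal :=
  ∫⁻ x in Ω, ∫⁻ z in Ω, ENNReal.ofReal (‖f x - f z‖ ^ n / dist x z ^ (2 * n - 1))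

lemma measurable_tdiff (n : ℕ) {f : Euc n → ℝ} (hf : Measurable f) :
    Measurable (fun q : (ℝ × Euc n) × Euc n => tdiff n f q.1.1 q.1.2 q.2) := by
  unfold tdiff
  refine Measurable.ite (measurableSet_lt (by fun_prop) (by fun_prop)) ?_ measurable_const
  fun_prop

lemma measurable_tdiff_right (n : ℕ) {f : Euc n → ℝ} (hf : Measurable f) (t : ℝ) (x : Euc n) :
    Measurable (fun z : Euc n => tdiff n f t x z) := by
  unfold tdiff
  refine Measurable.ite (measurableSet_lt (by fun_prop) (by fun_prop)) ?_ measurable_const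
  fun_prop

lemma measurable_gosc (n : ℕ) (Ω : Set (Euc n)) {f : Euc n → ℝ} (hf : Measurable f) :
    Measurable (fun q : ℝ × Euc n => gosc n Ω f q.1 q.2) := by
  unfold gosc
  refine Measurable.mul (by fun_prop) ?_
  exact (measurable_tdiff n hf).lintegral_prod_right'

lemma gosc_aux (n : ℕ) (hn : 2 ≤ n) {t : ℝ} (ht : 0 < t) :
    ENNReal.ofReal (t ^ (n + 1))⁻¹ ^ n * ENNReal.ofReal (t ^ n) ^ (n - 1)
      = ENNReal.ofReal (t ^ (2 * n))⁻¹ := by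
  obtain ⟨m, rfl⟩ : ∃ m, n = m + 1 := ⟨n - 1, by omega⟩
  rw [← ENNReal.ofReal_pow (by positivity), ← ENNReal.ofReal_pow (by positivity),
    ← ENNReal.ofReal_mul (by positivity)]
  congr 1
  simp only [Nat.add_sub_cancel, inv_pow, ← pow_mul]
  rw [inv_mul_eq_iff_eq_mul₀ (by positivity), eq_mul_inv_iff_mul_eq₀ (by positivity), ← pow_add]
  congr 1; ring

lemma gosc_pow_le (n : ℕ) (hn : 2 ≤ n) (Ω : Set (Euc n)) {f : Euc n → ℝ} (hf : Measurable f)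
    {t : ℝ} (ht : 0 < t) (x : Euc n) :
    gosc n Ω f t x ^ n ≤ volume (ball (0 : Euc n) 1) ^ (n - 1) *
      ∫⁻ z in Ω, ENNReal.ofReal ((t ^ (2 * n))⁻¹) * tdiff n f t x z ^ n := by
  have hn2 : (2 : ℝ) ≤ n := by exact_mod_cast hn
  have hn0 : (0 : ℝ) < n := by linarith
  have hn1 : (1 : ℝ) < n := by linarith
  have hpq : (n : ℝ).HolderConjugate ((n : ℝ) / (n - 1)) :=
    Real.HolderConjugate.conjExponent hn1
  have hm : Measurable (fun z => tdiff n f t x z) := measurable_tdiff_right n hf t x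
  have H := ENNReal.lintegral_mul_le_Lp_mul_Lq (volume.restrict Ω) hpq hm.aemeasurable
    (g := (ball x t).indicator (fun _ => 1))
    ((measurable_const.indicator measurableSet_ball).aemeasurable)
  have e1 : ∀ z, ((fun z => tdiff n f t x z) * ((ball x t).indicator (fun _ => (1 : ENNReal)) :
      Euc n → ENNReal) : Euc n → ENNReal) z = tdiff n f t x z := by
    intro z
    by_cases hz : dist z x < t
    · simp [Set.indicator, hz]
    · simp [Set.indicator, hz, tdiff]
  have e2 : ∀ z, ((ball x t).indicator (fun _ => (1 : ENNReal)) z) ^ ((n : ℝ) / (n - 1))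
      = (ball x t).indicator (fun _ => 1) z := by
    intro z
    by_cases hz : z ∈ ball x t
    · simp [hz]
    · simp only [hz, not_false_eq_true, Set.indicator_of_notMem]
      exact ENNReal.zero_rpow_of_pos (div_pos hn0 (by linarith))
  simp_rw [e1, e2, ENNReal.rpow_natCast] at H
  have e3 : ∫⁻ z in Ω, (ball x t).indicator (fun _ => (1 : ENNReal)) z
      ≤ ENNReal.ofReal (t ^ n) * volume (ball (0 : Euc n) 1) := by
    rw [lintegral_indicator measurableSet_ball, setLIntegral_one]
    refine (Measure.restrict_apply_le _ _).trans ?_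
    rw [Measure.addHaar_ball_of_pos _ _ ht]
    simp
  have H2 := H.trans (mul_le_mul_right (ENNReal.rpow_le_rpow e3 (by
    apply div_nonneg zero_le_one; apply div_nonneg <;> linarith)) _)
  have H3 := pow_le_pow_left' H2 n
  have e4 : (1 : ℝ) / ((n : ℝ) / (n - 1)) * n = ((n - 1 : ℕ) : ℝ) := by
    rw [Nat.cast_sub (by omega)]; field_simp; simp
  rw [mul_pow, ← ENNReal.rpow_natCast (_ ^ _) n, ← ENNReal.rpow_mul, one_div,
    inv_mul_cancel₀ hn0.ne', ENNReal.rpow_one, ← ENNReal.rpow_natCast (_ ^ _) n,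
    ← ENNReal.rpow_mul, e4, ENNReal.rpow_natCast, mul_pow] at H3
  unfold gosc
  rw [mul_pow, lintegral_const_mul _ (hm.pow_const n)]
  refine (mul_le_mul_right H3 _).trans (le_of_eq ?_)
  rw [← gosc_aux n hn ht]; ring

lemma lintegral_time (m : ℕ) (hm : 2 ≤ m) {d : ℝ} (hd : 0 < d) :
    ∫⁻ t in Set.Ioi d, ENNReal.ofReal ((t ^ m)⁻¹) ≤ ENNReal.ofReal ((d ^ (m - 1))⁻¹) := by
  have hm' : (-(m : ℝ)) < -1 := by
    have : (2 : ℝ) ≤ m := by exact_mod_cast hm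
    linarith
  have e : ∫⁻ t in Set.Ioi d, ENNReal.ofReal ((t ^ m)⁻¹)
      = ∫⁻ t in Set.Ioi d, ENNReal.ofReal (t ^ (-(m : ℝ))) := by
    refine setLIntegral_congr_fun measurableSet_Ioi fun t ht => ?_
    have : 0 < t := hd.trans ht
    simp only [Real.rpow_neg this.le, Real.rpow_natCast]
  rw [e, ← ofReal_integral_eq_lintegral_ofReal (integrableOn_Ioi_rpow_of_lt hm' hd)
    ((ae_restrict_mem measurableSet_Ioi).mono fun t ht => Real.rpow_nonneg (hd.trans ht).le _),
    integral_Ioi_rpow_of_lt hm' hd]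
  apply ENNReal.ofReal_le_ofReal
  have e2 : d ^ (-(m : ℝ) + 1) = (d ^ (m - 1))⁻¹ := by
    rw [← Real.rpow_natCast, ← Real.rpow_neg hd.le, Nat.cast_sub (by omega)]
    congr 1; push_cast; ring
  rw [e2, neg_div, ← div_neg, div_eq_mul_inv]
  have h1 : (1 : ℝ) ≤ -(-(m : ℝ) + 1) := by
    have : (2 : ℝ) ≤ m := by exact_mod_cast hm
    linarith
  exact mul_le_of_le_one_right (by positivity) (inv_le_one_of_one_le₀ h1)

lemma gosc_bound (n : ℕ) (hn : 2 ≤ n) (Ω : Set (Euc n)) {f : Euc n → ℝ} (hf : Measurable f) :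
    ∫⁻ t in Set.Ioi 0, ∫⁻ x in Ω, gosc n Ω f t x ^ n ≤
      volume (ball (0 : Euc n) 1) ^ (n - 1) * gagl n Ω f := by
  set B := volume (ball (0 : Euc n) 1) ^ (n - 1)
  set F : ℝ → Euc n → Euc n → ENNReal := fun t x z =>
    ENNReal.ofReal ((t ^ (2 * n))⁻¹) * tdiff n f t x z ^ n
  have hF : Measurable (fun q : (ℝ × Euc n) × Euc n => F q.1.1 q.1.2 q.2) :=
    Measurable.mul (by fun_prop) ((measurable_tdiff n hf).pow_const n)
  have hF1 : Measurable (fun q : ℝ × Euc n => ∫⁻ z in Ω, F q.1 q.2 z) :=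
    hF.lintegral_prod_right'
  calc ∫⁻ t in Set.Ioi 0, ∫⁻ x in Ω, gosc n Ω f t x ^ n
      ≤ ∫⁻ t in Set.Ioi 0, ∫⁻ x in Ω, B * ∫⁻ z in Ω, F t x z := by
        refine setLIntegral_mono' measurableSet_Ioi fun t ht => ?_
        exact lintegral_mono fun x => gosc_pow_le n hn Ω hf ht x
    _ = ∫⁻ t in Set.Ioi 0, B * ∫⁻ x in Ω, ∫⁻ z in Ω, F t x z := by
        refine lintegral_congr fun t => ?_
        rw [lintegral_const_mul]
        exact hF1.comp (by fun_prop : Measurable fun x : Euc n => (t, x))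
    _ = B * ∫⁻ t in Set.Ioi 0, ∫⁻ x in Ω, ∫⁻ z in Ω, F t x z := by
        rw [lintegral_const_mul]
        exact hF1.lintegral_prod_right'
    _ = B * ∫⁻ x in Ω, ∫⁻ t in Set.Ioi 0, ∫⁻ z in Ω, F t x z := by
        rw [lintegral_lintegral_swap]
        exact hF1.aemeasurable
    _ = B * ∫⁻ x in Ω, ∫⁻ z in Ω, ∫⁻ t in Set.Ioi 0, F t x z := by
        congr 1
        refine lintegral_congr fun x => ?_
        rw [lintegral_lintegral_swap]
        exact (hF.comp (by fun_prop : Measurable fun q : ℝ × Euc n => ((q.1, x), q.2))).aemeasurable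
    _ ≤ B * gagl n Ω f := by
        refine mul_le_mul_right (lintegral_mono fun x => lintegral_mono fun z => ?_) _
        simp only [F, tdiff]
        rcases eq_or_ne x z with rfl | hxz
        · simp [show n ≠ 0 by omega]
        have hd : 0 < dist z x := dist_pos.2 hxz.symm
        have : ∀ t ∈ Set.Ioi (0 : ℝ), ENNReal.ofReal (t ^ (2 * n))⁻¹ *
            (if dist z x < t then ‖f z - f x‖ₑ else 0) ^ n =
            (Set.Ioi (dist z x)).indicator
              (fun t => ENNReal.ofReal (t ^ (2 * n))⁻¹ * ‖f z - f x‖ₑ ^ n) t := by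
          intro t ht
          by_cases h : dist z x < t
          · simp [h]
          · simp [h, show n ≠ 0 by omega]
        rw [setLIntegral_congr_fun measurableSet_Ioi this]
        refine (setLIntegral_le_lintegral _ _).trans ?_
        rw [lintegral_indicator measurableSet_Ioi, lintegral_mul_const _ (by fun_prop)]
        refine (mul_le_mul_left (lintegral_time (2 * n) (by omega) hd) _).trans (le_of_eq ?_)
        rw [← ofReal_norm, ← ENNReal.ofReal_pow (norm_nonneg _),
          ← ENNReal.ofReal_mul (by positivity), mul_comm, dist_comm, norm_sub_rev, div_eq_mul_inv]


/-- A piecewise linear cutoff. -/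
def etaF (r : ℝ) : ℝ := max 0 (min 1 (2 - |r|))

lemma etaF_cont : Continuous etaF := by unfold etaF; fun_prop

lemma etaF_nonneg (r : ℝ) : 0 ≤ etaF r := le_max_left _ _

lemma etaF_le_one (r : ℝ) : etaF r ≤ 1 := max_le zero_le_one (min_le_left _ _)

lemma etaF_one {r : ℝ} (h : |r| ≤ 1) : etaF r = 1 := by
  unfold etaF
  rw [min_eq_left (by linarith), max_eq_right zero_le_one]

lemma etaF_zero {r : ℝ} (h : 2 ≤ |r|) : etaF r = 0 := by
  unfold etaF
  rw [max_eq_left]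
  exact (min_le_right _ _).trans (by linarith)

/-- Primitive of the cutoff. -/
def bF (r : ℝ) : ℝ := ∫ s in (0 : ℝ)..r, etaF s

/-- Soft truncation. -/
def hF (r : ℝ) : ℝ := r - bF r

lemma bF_deriv (r : ℝ) : HasDerivAt bF (etaF r) r :=
  intervalIntegral.integral_hasDerivAt_right (etaF_cont.intervalIntegrable _ _)
    (etaF_cont.stronglyMeasurableAtFilter _ _) etaF_cont.continuousAt

lemma hF_deriv (r : ℝ) : HasDerivAt hF (1 - etaF r) r := (hasDerivAt_id r).sub (bF_deriv r)

lemma hF_contDiff : ContDiff ℝ 1 hF := by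
  rw [contDiff_one_iff_deriv]
  refine ⟨fun r => (hF_deriv r).differentiableAt, ?_⟩
  have : deriv hF = fun r => 1 - etaF r := funext fun r => (hF_deriv r).deriv
  rw [this]
  exact continuous_const.sub etaF_cont

lemma bF_abs_le_abs (r : ℝ) : |bF r| ≤ |r| := by
  have := intervalIntegral.norm_integral_le_of_norm_le_const (a := 0) (b := r) (f := etaF) (C := 1)
    (fun x _ => by rw [Real.norm_eq_abs, abs_of_nonneg (etaF_nonneg x)]; exact etaF_le_one x)
  simpa [bF] using this

lemma bF_abs_le (r : ℝ) : |bF r| ≤ 2 := by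
  rcases le_total |r| 2 with h | h
  · exact (bF_abs_le_abs r).trans h
  · have key : ∀ c : ℝ, |c| = 2 → (∀ s ∈ Set.uIcc c r, 2 ≤ |s|) → |bF r| ≤ 2 := by
      intro c hc hs
      have : bF r = bF c := by
        unfold bF
        rw [← intervalIntegral.integral_add_adjacent_intervals (b := c)
          (etaF_cont.intervalIntegrable _ _) (etaF_cont.intervalIntegrable _ _),
          intervalIntegral.integral_congr (g := fun _ => 0) (a := c) (b := r)
            (fun s hs' => etaF_zero (hs s hs'))]
        simp
      rw [this]
      exact (bF_abs_le_abs c).trans hc.le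
    rcases le_total 0 r with h0 | h0
    · rw [abs_of_nonneg h0] at h
      refine key 2 (by norm_num) fun s hs => ?_
      rw [Set.uIcc_of_le h] at hs
      exact hs.1.trans (le_abs_self s)
    · rw [abs_of_nonpos h0] at h
      refine key (-2) (by norm_num) fun s hs => ?_
      rw [Set.uIcc_of_ge (by linarith)] at hs
      have := neg_le_abs s
      linarith [hs.2]

lemma hF_zero {r : ℝ} (h : |r| ≤ 1) : hF r = 0 := by
  have : bF r = r := by
    unfold bF
    rw [intervalIntegral.integral_congr (g := fun _ => 1)]
    · simp
    · intro s hs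
      refine etaF_one ?_
      rw [Set.mem_uIcc] at hs
      rw [abs_le] at h ⊢
      rcases hs with hs | hs <;> constructor <;> linarith [hs.1, hs.2]
  simp [hF, this]

lemma hF_sub_abs_le (r : ℝ) : |hF r - r| ≤ 2 := by
  have := bF_abs_le r
  rw [hF, sub_sub_cancel_left, abs_neg]; exact this

lemma hF_time_abs_le (r : ℝ) : |hF r - r * (1 - etaF r)| ≤ 4 := by
  have h1 : hF r - r * (1 - etaF r) = r * etaF r - bF r := by unfold hF; ring
  have h2 : |r * etaF r| ≤ 2 := by
    rw [abs_mul, abs_of_nonneg (etaF_nonneg r)]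
    rcases le_total |r| 2 with h | h
    · calc |r| * etaF r ≤ 2 * 1 := mul_le_mul h (etaF_le_one r) (etaF_nonneg r) (by norm_num)
        _ = 2 := by norm_num
    · rw [etaF_zero h]; norm_num
  rw [h1]
  exact (abs_sub _ _).trans (by linarith [bF_abs_le r])

lemma hF_abs_le (r : ℝ) : |hF r| ≤ 2 * |r| := by
  unfold hF
  exact (abs_sub _ _).trans (by linarith [bF_abs_le_abs r])

/-- The extension of the test function to the half space. -/
def PsiF (n : ℕ) (ψ : Euc n → ℝ) (q : ℝ × Euc n) : ℝ := q.1 * hF (ψ q.2 / q.1)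

lemma PsiF_contDiffOn (n : ℕ) {ψ : Euc n → ℝ} (hψ : ContDiff ℝ 1 ψ) :
    ContDiffOn ℝ 1 (PsiF n ψ) (Set.Ioi 0 ×ˢ Set.univ) := by
  unfold PsiF
  refine contDiff_fst.contDiffOn.mul (hF_contDiff.comp_contDiffOn ?_)
  exact ((hψ.comp contDiff_snd).contDiffOn).div contDiff_fst.contDiffOn
    fun q hq => ne_of_gt hq.1

lemma PsiF_time (n : ℕ) {ψ : Euc n → ℝ} (hψ : ContDiff ℝ 1 ψ) {t : ℝ} (ht : 0 < t) (x : Euc n) :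
    fderiv ℝ (PsiF n ψ) (t, x) (1, 0) =
      hF (ψ x / t) - ψ x / t * (1 - etaF (ψ x / t)) := by
  have hd : DifferentiableAt ℝ (PsiF n ψ) (t, x) :=
    ((PsiF_contDiffOn n hψ).contDiffAt ((isOpen_slab n).mem_nhds
      (show (t, x) ∈ _ from ⟨ht, trivial⟩))).differentiableAt one_ne_zero
  have h1 : HasDerivAt (fun s => PsiF n ψ (s, x)) (fderiv ℝ (PsiF n ψ) (t, x) (1, 0)) t :=
    hasDerivAt_time hd
  have h2 : HasDerivAt (fun s : ℝ => ψ x / s) (-(ψ x / t ^ 2)) t := by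
    have := (hasDerivAt_inv ht.ne').const_mul (ψ x)
    have e : ψ x * -(t ^ 2)⁻¹ = -(ψ x / t ^ 2) := by ring
    rw [e] at this
    exact this
  have h3 := (hasDerivAt_id t).mul ((hF_deriv (ψ x / t)).comp t h2)
  have h4 := h1.unique h3
  rw [h4]
  simp only [id, Function.comp]
  field_simp
  ring

lemma PsiF_space (n : ℕ) {ψ : Euc n → ℝ} (hψ : ContDiff ℝ 1 ψ) {t : ℝ} (ht : 0 < t) (x v : Euc n) :
    fderiv ℝ (fun y => PsiF n ψ (t, y)) x v = (1 - etaF (ψ x / t)) * fderiv ℝ ψ x v := by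
  have hd := (hψ.differentiable one_ne_zero x).hasFDerivAt
  have h1 := ((hF_deriv (ψ x / t)).comp_hasFDerivAt x (hd.mul_const t⁻¹)).const_mul t
  have : (fun y => PsiF n ψ (t, y)) = fun y => t * (hF ∘ fun y => ψ y * t⁻¹) y := by
    funext y; simp [PsiF, div_eq_mul_inv]
  rw [this, HasFDerivAt.fderiv h1]
  simp only [smul_apply, smul_eq_mul]
  field_simp

lemma PsiF_zero (n : ℕ) {ψ : Euc n → ℝ} {t : ℝ} (ht : 0 < t) {x : Euc n} (h : |ψ x| ≤ t) :
    PsiF n ψ (t, x) = 0 := by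
  have : |ψ x / t| ≤ 1 := by
    rw [abs_div, abs_of_pos ht]; exact (div_le_one ht).2 h
  simp [PsiF, hF_zero this]

lemma PsiF_time_zero (n : ℕ) {ψ : Euc n → ℝ} (hψ : ContDiff ℝ 1 ψ) {t : ℝ} (ht : 0 < t)
    {x : Euc n} (h : |ψ x| ≤ t) : fderiv ℝ (PsiF n ψ) (t, x) (1, 0) = 0 := by
  have : |ψ x / t| ≤ 1 := by
    rw [abs_div, abs_of_pos ht]; exact (div_le_one ht).2 h
  rw [PsiF_time n hψ ht, hF_zero this, etaF_one this]; ring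

lemma PsiF_space_zero (n : ℕ) {ψ : Euc n → ℝ} (hψ : ContDiff ℝ 1 ψ) {t : ℝ} (ht : 0 < t)
    {x : Euc n} (h : |ψ x| ≤ t) (v : Euc n) : fderiv ℝ (fun y => PsiF n ψ (t, y)) x v = 0 := by
  have : |ψ x / t| ≤ 1 := by
    rw [abs_div, abs_of_pos ht]; exact (div_le_one ht).2 h
  rw [PsiF_space n hψ ht, etaF_one this]; ring

lemma PsiF_time_le (n : ℕ) {ψ : Euc n → ℝ} (hψ : ContDiff ℝ 1 ψ) {t : ℝ} (ht : 0 < t)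
    (x : Euc n) : |fderiv ℝ (PsiF n ψ) (t, x) (1, 0)| ≤ 4 := by
  rw [PsiF_time n hψ ht]; exact hF_time_abs_le _

lemma PsiF_space_le (n : ℕ) {ψ : Euc n → ℝ} (hψ : ContDiff ℝ 1 ψ) {t : ℝ} (ht : 0 < t)
    (x v : Euc n) : |fderiv ℝ (fun y => PsiF n ψ (t, y)) x v| ≤ |fderiv ℝ ψ x v| := by
  rw [PsiF_space n hψ ht, abs_mul]
  refine mul_le_of_le_one_left (abs_nonneg _) ?_
  rw [abs_le]
  constructor <;> linarith [etaF_nonneg (ψ x / t), etaF_le_one (ψ x / t)]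

lemma PsiF_abs_le (n : ℕ) (ψ : Euc n → ℝ) {t : ℝ} (ht : 0 < t) (x : Euc n) :
    |PsiF n ψ (t, x)| ≤ 2 * |ψ x| := by
  simp only [PsiF, abs_mul, abs_of_pos ht]
  calc t * |hF (ψ x / t)| ≤ t * (2 * |ψ x / t|) := by gcongr; exact hF_abs_le _
    _ = 2 * |ψ x| := by rw [abs_div, abs_of_pos ht]; field_simp

lemma PsiF_sub_le (n : ℕ) (ψ : Euc n → ℝ) {t : ℝ} (ht : 0 < t) (x : Euc n) :
    |PsiF n ψ (t, x) - ψ x| ≤ 2 * t := by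
  have : PsiF n ψ (t, x) - ψ x = t * (hF (ψ x / t) - ψ x / t) := by
    simp only [PsiF]; field_simp
  rw [this, abs_mul, abs_of_pos ht, mul_comm]
  gcongr
  exact hF_sub_abs_le _

lemma PsiF_tendsto (n : ℕ) (ψ : Euc n → ℝ) (x : Euc n) :
    Tendsto (fun t => PsiF n ψ (t, x)) (𝓝[>] 0) (𝓝 (ψ x)) := by
  rw [tendsto_iff_norm_sub_tendsto_zero]
  have h : Tendsto (fun t : ℝ => 2 * t) (𝓝[>] 0) (𝓝 0) := by
    have : Tendsto (fun t : ℝ => 2 * t) (𝓝 0) (𝓝 (2 * 0)) := tendsto_id.const_mul 2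
    rw [mul_zero] at this
    exact this.mono_left nhdsWithin_le_nhds
  refine squeeze_zero' (Eventually.of_forall fun t => norm_nonneg _) ?_ h
  filter_upwards [self_mem_nhdsWithin] with t ht
  exact PsiF_sub_le n ψ ht x


lemma psi_ball {n : ℕ} {Ω : Set (Euc n)} {ψ : Euc n → ℝ} (hψ : ContDiff ℝ 1 ψ)
    (hs : tsupport ψ ⊆ Ω) (hL : ∀ x, ‖fderiv ℝ ψ x‖ ≤ 1) {t : ℝ} {x : Euc n}
    (h : t < |ψ x|) : ball x t ⊆ Ω := by
  intro y hy
  by_contra hyΩ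
  have hy0 : ψ y = 0 := image_eq_zero_of_notMem_tsupport fun h => hyΩ (hs h)
  have hlip : LipschitzWith 1 ψ :=
    lipschitzWith_of_nnnorm_fderiv_le (hψ.differentiable one_ne_zero) fun x => by
      exact_mod_cast hL x
  have := hlip.dist_le_mul x y
  rw [Real.dist_eq, hy0, sub_zero, NNReal.coe_one, one_mul, dist_comm] at this
  exact absurd (mem_ball.1 hy) (by linarith)

lemma gosc_eq_ball (n : ℕ) {Ω : Set (Euc n)} (f : Euc n → ℝ) {t : ℝ} (x : Euc n)
    (hb : ball x t ⊆ Ω) :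
    gosc n Ω f t x = ENNReal.ofReal ((t ^ (n + 1))⁻¹) * ∫⁻ z in ball x t, ‖f z - f x‖ₑ := by
  unfold gosc
  congr 1
  have : ∀ z, tdiff n f t x z = (ball x t).indicator (fun z => ‖f z - f x‖ₑ) z := by
    intro z
    by_cases hz : dist z x < t
    · simp [Set.indicator, hz, tdiff]
    · simp [Set.indicator, hz, tdiff]
  simp_rw [this]
  rw [lintegral_indicator measurableSet_ball, Measure.restrict_restrict measurableSet_ball,
    Set.inter_eq_left.2 hb]

lemma fderiv_moll_le_gosc (n : ℕ) {C : ℝ} (hC0 : 0 < C)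
    (hC : ∀ f : Euc n → ℝ, LocallyIntegrable f → ∀ t > 0, ∀ x,
      ‖fderiv ℝ (moll n f) (t, x)‖ ≤ C * (t ^ (n + 1))⁻¹ * ∫ z in ball x t, |f z|)
    {Ω : Set (Euc n)} {f : Euc n → ℝ} (hf : LocallyIntegrable f) {t : ℝ} (ht : 0 < t) (x : Euc n)
    (hb : ball x t ⊆ Ω) :
    ENNReal.ofReal ‖fderiv ℝ (moll n f) (t, x)‖ ≤ ENNReal.ofReal C * gosc n Ω f t x := by
  have h := fderiv_moll_bound_sub hC f hf t ht x
  have hintg : IntegrableOn (fun z => f z - f x) (ball x t) := by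
    refine Integrable.sub ?_ ?_
    · exact (hf.integrableOn_isCompact (isCompact_closedBall x t)).mono_set ball_subset_closedBall
    · exact integrableOn_const (measure_ball_lt_top.ne)
  rw [gosc_eq_ball n f x hb, ← mul_assoc, ← ENNReal.ofReal_mul hC0.le]
  refine (ENNReal.ofReal_le_ofReal h).trans ?_
  rw [ENNReal.ofReal_mul (by positivity)]
  refine mul_le_mul_right (le_of_eq ?_) _
  rw [ofReal_integral_eq_lintegral_ofReal hintg.abs (Eventually.of_forall fun z => abs_nonneg _)]
  refine lintegral_congr fun z => ?_
  rw [← Real.norm_eq_abs, ofReal_norm]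

lemma abs_fderiv_apply_le {E : Type*} [NormedAddCommGroup E] [NormedSpace ℝ E]
    (L : E →L[ℝ] ℝ) {v : E} (hv : ‖v‖ ≤ 1) : |L v| ≤ ‖L‖ := by
  have := L.le_opNorm v
  rw [Real.norm_eq_abs] at this
  exact this.trans (mul_le_of_le_one_right (norm_nonneg _) hv)

lemma norm_single_le (n : ℕ) (j : Fin n) : ‖(EuclideanSpace.single j (1 : ℝ) : Euc n)‖ ≤ 1 := by
  simp

lemma norm_pair_single_le (n : ℕ) (j : Fin n) :
    ‖((0 : ℝ), (EuclideanSpace.single j (1 : ℝ) : Euc n))‖ ≤ 1 := by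
  simp [Prod.norm_def]

lemma norm_pair_one_le (n : ℕ) : ‖((1 : ℝ), (0 : Euc n))‖ ≤ 1 := by
  simp [Prod.norm_def]

/-- pointwise bound of the Stokes integrand. -/
lemma integrand_bound (n : ℕ) {W : Fin n → ℝ × Euc n → ℝ}
    (hW : ∀ i, ContDiffOn ℝ 3 (W i) (Set.Ioi 0 ×ˢ Set.univ)) {ψ : Euc n → ℝ}
    (hψ : ContDiff ℝ 1 ψ) (hL : ∀ x, ‖fderiv ℝ ψ x‖ ≤ 1) {t : ℝ} (ht : 0 < t) (x : Euc n) :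
    |fderiv ℝ (PsiF n ψ) (t, x) (1, 0) * (gradMat n (fun i y => W i (t, y)) x).det -
      ∑ i, fderiv ℝ (W i) (t, x) (1, 0) *
        (gradMat n (Function.update (fun i y => W i (t, y)) i (fun y => PsiF n ψ (t, y))) x).det|
      ≤ ((4 + n) * n.factorial) * ∏ i, ‖fderiv ℝ (W i) (t, x)‖ := by
  have hent : ∀ i j, |fderiv ℝ (fun y => W i (t, y)) x (EuclideanSpace.single j 1)|
      ≤ ‖fderiv ℝ (W i) (t, x)‖ := by
    intro i j
    rw [fderiv_slice (slab_diff ((hW i).of_le (by norm_num)) ht x)]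
    exact abs_fderiv_apply_le _ (norm_pair_single_le n j)
  have h1 : |(gradMat n (fun i y => W i (t, y)) x).det| ≤
      n.factorial * ∏ i, ‖fderiv ℝ (W i) (t, x)‖ := abs_det_le _ _ hent
  have h2 : ∀ i, |fderiv ℝ (W i) (t, x) (1, 0) *
        (gradMat n (Function.update (fun i y => W i (t, y)) i (fun y => PsiF n ψ (t, y))) x).det|
      ≤ n.factorial * ∏ i, ‖fderiv ℝ (W i) (t, x)‖ := by
    intro i
    have h3 : |(gradMat n (Function.update (fun i y => W i (t, y)) i
        (fun y => PsiF n ψ (t, y))) x).det| ≤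
        n.factorial * ∏ k, Function.update (fun k => ‖fderiv ℝ (W k) (t, x)‖) i 1 k := by
      refine abs_det_le _ _ fun k j => ?_
      show |fderiv ℝ (Function.update (fun i y => W i (t, y)) i
        (fun y => PsiF n ψ (t, y)) k) x (EuclideanSpace.single j 1)| ≤ _
      rcases eq_or_ne k i with rfl | hk
      · simp only [Function.update_self]
        exact (PsiF_space_le n hψ ht x _).trans
          ((abs_fderiv_apply_le _ (norm_single_le n j)).trans (hL x))
      · simp only [Function.update_of_ne hk]
        exact hent k j
    rw [abs_mul]
    have h4 : |fderiv ℝ (W i) (t, x) (1, 0)| ≤ ‖fderiv ℝ (W i) (t, x)‖ :=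
      abs_fderiv_apply_le _ (norm_pair_one_le n)
    refine (mul_le_mul h4 h3 (abs_nonneg _) (norm_nonneg _)).trans (le_of_eq ?_)
    rw [Finset.prod_update_of_mem (Finset.mem_univ i), one_mul, ← Finset.erase_eq,
      ← Finset.mul_prod_erase _ _ (Finset.mem_univ i)]
    ring
  set P := ∏ i, ‖fderiv ℝ (W i) (t, x)‖
  have hP : 0 ≤ P := Finset.prod_nonneg fun i _ => norm_nonneg _
  refine (abs_sub _ _).trans ?_
  have h5 := (Finset.abs_sum_le_sum_abs (fun i => fderiv ℝ (W i) (t, x) (1, 0) *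
        (gradMat n (Function.update (fun i y => W i (t, y)) i (fun y => PsiF n ψ (t, y))) x).det)
        Finset.univ).trans (Finset.sum_le_sum fun i _ => h2 i)
  simp only [Finset.sum_const, Finset.card_univ, Fintype.card_fin, nsmul_eq_mul] at h5
  rw [abs_mul]
  have h6 := mul_le_mul (PsiF_time_le n hψ ht x) h1 (abs_nonneg _) (by norm_num)
  calc _ ≤ 4 * (n.factorial * P) + n * (n.factorial * P) := add_le_add h6 h5
    _ = _ := by ring

lemma integrand_zero (n : ℕ) {W : Fin n → ℝ × Euc n → ℝ} {ψ : Euc n → ℝ}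
    (hψ : ContDiff ℝ 1 ψ) {t : ℝ} (ht : 0 < t) {x : Euc n} (h : |ψ x| ≤ t) :
    fderiv ℝ (PsiF n ψ) (t, x) (1, 0) * (gradMat n (fun i y => W i (t, y)) x).det -
      ∑ i, fderiv ℝ (W i) (t, x) (1, 0) *
        (gradMat n (Function.update (fun i y => W i (t, y)) i (fun y => PsiF n ψ (t, y))) x).det
      = 0 := by
  rw [PsiF_time_zero n hψ ht h, zero_mul, zero_sub, neg_eq_zero]
  refine Finset.sum_eq_zero fun i _ => ?_
  rw [Matrix.det_eq_zero_of_row_eq_zero i, mul_zero]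
  intro j
  show fderiv ℝ (Function.update (fun i y => W i (t, y)) i
        (fun y => PsiF n ψ (t, y)) i) x (EuclideanSpace.single j 1) = 0
  simp only [Function.update_self]
  exact PsiF_space_zero n hψ ht h _


lemma holder_gosc (n : ℕ) (hn : 2 ≤ n) (Ω : Set (Euc n)) {f : Fin n → Euc n → ℝ}
    (hf : ∀ i, Measurable (f i)) :
    ∫⁻ t in Set.Ioi 0, ∫⁻ x in Ω, ∏ i, gosc n Ω (f i) t x ≤
      volume (ball (0 : Euc n) 1) ^ (n - 1) * ∏ i, gagl n Ω (f i) ^ (1 / (n : ℝ)) := by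
  have hn0 : (n : ℝ) ≠ 0 := by
    have : (2 : ℝ) ≤ n := by exact_mod_cast hn
    linarith
  set B := volume (ball (0 : Euc n) 1) ^ (n - 1)
  have hm : ∀ i, Measurable (fun q : ℝ × Euc n => gosc n Ω (f i) q.1 q.2) := fun i =>
    measurable_gosc n Ω (hf i)
  have h1 : ∫⁻ t in Set.Ioi 0, ∫⁻ x in Ω, ∏ i, gosc n Ω (f i) t x =
      ∫⁻ q, ∏ i, gosc n Ω (f i) q.1 q.2 ∂((volume.restrict (Set.Ioi 0)).prod (volume.restrict Ω)) :=
    lintegral_lintegral (Finset.measurable_fun_prod _ fun i _ => hm i).aemeasurable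
  have h2 : ∀ i, ∫⁻ q, gosc n Ω (f i) q.1 q.2 ^ n
      ∂((volume.restrict (Set.Ioi 0)).prod (volume.restrict Ω)) ≤ B * gagl n Ω (f i) := by
    intro i
    refine le_trans (le_of_eq ?_) (gosc_bound n hn Ω (hf i))
    exact (lintegral_lintegral (f := fun t x => gosc n Ω (f i) t x ^ n) ((hm i).pow_const n).aemeasurable).symm
  rw [h1]
  have h3 := ENNReal.lintegral_prod_norm_pow_le
    (μ := (volume.restrict (Set.Ioi (0 : ℝ))).prod (volume.restrict Ω)) Finset.univ
    (f := fun i q => gosc n Ω (f i) q.1 q.2 ^ n) (p := fun _ => 1 / (n : ℝ))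
    (fun i _ => ((hm i).pow_const n).aemeasurable) (by simp [hn0]) (fun i _ => by positivity)
  have e1 : ∀ a : ENNReal, (a ^ n) ^ (1 / (n : ℝ)) = a := by
    intro a
    rw [← ENNReal.rpow_natCast, ← ENNReal.rpow_mul, mul_one_div_cancel hn0, ENNReal.rpow_one]
  simp only [e1] at h3
  refine h3.trans ?_
  calc _ ≤ ∏ i, (B * gagl n Ω (f i)) ^ (1 / (n : ℝ)) :=
        Finset.prod_le_prod' fun i _ => ENNReal.rpow_le_rpow (h2 i) (by positivity)
    _ = _ := by
        simp_rw [ENNReal.mul_rpow_of_nonneg _ _ (show (0 : ℝ) ≤ 1 / n by positivity)]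
        rw [Finset.prod_mul_distrib]
        congr 1
        simp only [Finset.prod_const, Finset.card_univ, Fintype.card_fin]
        rw [← ENNReal.rpow_natCast (_ ^ _) n, ← ENNReal.rpow_mul, one_div_mul_cancel hn0,
          ENNReal.rpow_one]

lemma stokes_bound (n : ℕ) (hn : 2 ≤ n) {C : ℝ} (hC0 : 0 < C)
    (hC : ∀ f : Euc n → ℝ, LocallyIntegrable f → ∀ t > 0, ∀ x,
      ‖fderiv ℝ (moll n f) (t, x)‖ ≤ C * (t ^ (n + 1))⁻¹ * ∫ z in ball x t, |f z|)
    {Ω : Set (Euc n)} (hΩ : MeasurableSet Ω) {f : Fin n → Euc n → ℝ} (hfm : ∀ i, Measurable (f i))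
    (hf : ∀ i, LocallyIntegrable (f i)) {ψ : Euc n → ℝ} (hψ : Cc1 n Ω ψ)
    (hL : ∀ x, ‖fderiv ℝ ψ x‖ ≤ 1) {ε : ℝ} (hε : 0 < ε) :
    ‖∫ x, PsiF n ψ (ε, x) * (gradMat n (fun i y => moll n (f i) (ε, y)) x).det‖ₑ ≤
      ENNReal.ofReal ((4 + n) * n.factorial * C ^ n) * (volume (ball (0 : Euc n) 1) ^ (n - 1) *
        ∏ i, gagl n Ω (f i) ^ (1 / (n : ℝ))) := by
  obtain ⟨hψ1, hψc, hψs⟩ := hψ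
  have hW : ∀ i, ContDiffOn ℝ 3 (moll n (f i)) (Set.Ioi 0 ×ˢ Set.univ) := fun i =>
    moll_contDiffOn (m := 3) (hf i)
  obtain ⟨M, hM⟩ := hψc.exists_bound_of_continuous hψ1.continuous
  have hT : ∀ x, PsiF n ψ (max M ε, x) = 0 := fun x =>
    PsiF_zero n (hε.trans_le (le_max_right _ _)) ((hM x).trans (le_max_left _ _))
  have hK : ∀ t, 0 < t → ∀ x, x ∉ tsupport ψ → PsiF n ψ (t, x) = 0 := fun t ht x hx =>
    PsiF_zero n ht (by rw [image_eq_zero_of_notMem_tsupport hx]; simpa using ht.le)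
  rw [stokes hW (PsiF_contDiffOn n hψ1) hψc hK hT hε (le_max_right M ε), enorm_neg]
  refine le_trans ?_ (mul_le_mul_right (holder_gosc n hn Ω hfm) _)
  refine (enorm_integral_le_lintegral_enorm _).trans ?_
  rw [← lintegral_const_mul' _ _ ENNReal.ofReal_ne_top]
  refine le_trans ?_ (lintegral_mono_set (s := Set.Ioc ε (max M ε)) fun t ht => hε.trans ht.1)
  refine setLIntegral_mono' measurableSet_Ioc fun t ht => ?_
  have ht0 : 0 < t := hε.trans ht.1
  refine (enorm_integral_le_lintegral_enorm _).trans ?_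
  rw [← lintegral_const_mul' _ _ ENNReal.ofReal_ne_top, ← lintegral_indicator hΩ]
  refine lintegral_mono fun x => ?_
  rcases le_or_gt |ψ x| t with h | h
  · rw [integrand_zero n hψ1 ht0 h]; simp
  · have hb := psi_ball hψ1 hψs hL h
    have hx : x ∈ Ω := hb (mem_ball_self ht0)
    rw [Set.indicator_of_mem hx, ← ofReal_norm, Real.norm_eq_abs]
    refine (ENNReal.ofReal_le_ofReal (integrand_bound n hW hψ1 hL ht0 x)).trans ?_
    rw [ENNReal.ofReal_mul (by positivity), ENNReal.ofReal_mul (q := C ^ n) (by positivity),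
      mul_assoc]
    refine mul_le_mul_right ?_ _
    rw [ENNReal.ofReal_prod_of_nonneg (fun i _ => norm_nonneg _), ENNReal.ofReal_pow hC0.le]
    calc _ ≤ ∏ i, (ENNReal.ofReal C * gosc n Ω (f i) t x) :=
          Finset.prod_le_prod' fun i _ => fderiv_moll_le_gosc n hC0 hC (hf i) ht0 x hb
      _ = _ := by rw [Finset.prod_mul_distrib]; simp


lemma fderiv_moll_lip_bound (n : ℕ) {C : ℝ} (hC0 : 0 < C)
    (hC : ∀ f : Euc n → ℝ, LocallyIntegrable f → ∀ t > 0, ∀ x,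
      ‖fderiv ℝ (moll n f) (t, x)‖ ≤ C * (t ^ (n + 1))⁻¹ * ∫ z in ball x t, |f z|)
    {f : Euc n → ℝ} (hf : LocallyIntegrable f) {t : ℝ} (ht : 0 < t) (x : Euc n) {A : ℝ}
    (hA : 0 ≤ A) (hb : ∀ z ∈ ball x t, |f z - f x| ≤ A * dist z x) :
    ‖fderiv ℝ (moll n f) (t, x)‖ ≤ C * A * (volume (ball (0 : Euc n) 1)).toReal := by
  refine (fderiv_moll_bound_sub hC f hf t ht x).trans ?_
  have h1 : ∫ z in ball x t, |f z - f x| ≤ A * t * (volume (ball x t)).toReal := by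
    have := norm_setIntegral_le_of_norm_le_const (μ := volume) (s := ball x t)
      (f := fun z => |f z - f x|) (C := A * t) measure_ball_lt_top (fun z hz => by
        rw [Real.norm_eq_abs, abs_abs]
        exact (hb z hz).trans (mul_le_mul_of_nonneg_left (mem_ball.1 hz).le hA))
    exact (le_abs_self _).trans this
  rw [Measure.addHaar_ball_of_pos _ _ ht, ENNReal.toReal_mul,
    ENNReal.toReal_ofReal (by positivity)] at h1
  calc _ ≤ C * (t ^ (n + 1))⁻¹ * (A * t * (t ^ Module.finrank ℝ (Euc n) *
        (volume (ball (0 : Euc n) 1)).toReal)) := by gcongr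
    _ = _ := by
      rw [finrank_euclideanSpace_fin]
      field_simp
      ring

lemma limit_det (n : ℕ) {C : ℝ} (hC0 : 0 < C)
    (hC : ∀ f : Euc n → ℝ, LocallyIntegrable f → ∀ t > 0, ∀ x,
      ‖fderiv ℝ (moll n f) (t, x)‖ ≤ C * (t ^ (n + 1))⁻¹ * ∫ z in ball x t, |f z|)
    {Ω : Set (Euc n)} {f : Fin n → Euc n → ℝ}
    (hf : ∀ i, LocallyIntegrable (f i)) {A : ℝ} (hA : 0 ≤ A)
    (hlip : ∀ i, ∀ x ∈ Ω, ∀ z ∈ Ω, |f i z - f i x| ≤ A * dist z x)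
    (hd : ∀ i, ∀ x ∈ Ω, DifferentiableAt ℝ (f i) x) {ψ : Euc n → ℝ} (hψ : Cc1 n Ω ψ)
    (hL : ∀ x, ‖fderiv ℝ ψ x‖ ≤ 1) :
    Tendsto (fun ε => ∫ x, PsiF n ψ (ε, x) * (gradMat n (fun i y => moll n (f i) (ε, y)) x).det)
      (𝓝[>] 0) (𝓝 (∫ x, ψ x * (gradMat n f x).det)) := by
  obtain ⟨hψ1, hψc, hψs⟩ := hψ
  have hW : ∀ i, ContDiffOn ℝ 1 (moll n (f i)) (Set.Ioi 0 ×ˢ Set.univ) := fun i =>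
    moll_contDiffOn (m := 1) (hf i)
  obtain ⟨M, hM⟩ := hψc.exists_bound_of_continuous hψ1.continuous
  set D := C * A * (volume (ball (0 : Euc n) 1)).toReal
  have hD : 0 ≤ D := by positivity
  refine tendsto_integral_filter_of_dominated_convergence
    ((tsupport ψ).indicator fun _ => 2 * M * (n.factorial * ∏ _i : Fin n, D)) ?_ ?_ ?_ ?_
  · filter_upwards [self_mem_nhdsWithin] with ε hε
    refine Continuous.aestronglyMeasurable (Continuous.mul ?_ ?_)
    · exact (contDiff_slice (PsiF_contDiffOn n hψ1) hε).continuous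
    · exact continuous_gradMat_det _ fun i => contDiff_slice (hW i) hε
  · filter_upwards [self_mem_nhdsWithin] with ε hε
    refine Eventually.of_forall fun x => ?_
    have hM0 : 0 ≤ M := (norm_nonneg _).trans (hM x)
    rcases le_or_gt |ψ x| ε with h | h
    · rw [PsiF_zero n hε h, zero_mul, norm_zero]
      refine Set.indicator_nonneg (fun _ _ => ?_) x
      positivity
    · have hb := psi_ball hψ1 hψs hL h
      have hx : x ∈ Ω := hb (mem_ball_self hε)
      have hxK : x ∈ tsupport ψ := by
        apply subset_tsupport
        intro h0
        rw [h0, abs_zero] at h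
        exact lt_asymm h hε
      rw [Set.indicator_of_mem hxK, norm_mul]
      refine mul_le_mul ?_ ?_ (norm_nonneg _) (by positivity)
      · exact (PsiF_abs_le n ψ hε x).trans (by linarith [show |ψ x| ≤ M from hM x])
      · refine abs_det_le _ _ fun i j => ?_
        show |fderiv ℝ (fun y => moll n (f i) (ε, y)) x (EuclideanSpace.single j 1)| ≤ D
        rw [fderiv_slice (slab_diff (hW i) hε x)]
        refine (abs_fderiv_apply_le _ (norm_pair_single_le n j)).trans ?_
        exact fderiv_moll_lip_bound n hC0 hC (hf i) hε x hA fun z hz => hlip i x hx z (hb hz)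
  · refine (integrable_indicator_iff (isClosed_tsupport ψ).measurableSet).2 ?_
    exact integrableOn_const (IsCompact.measure_lt_top hψc).ne
  · refine Eventually.of_forall fun x => ?_
    by_cases hx : x ∈ Ω
    · refine (PsiF_tendsto n ψ x).mul ?_
      simp only [det_rows]
      refine tendsto_finsetSum _ fun σ _ => Tendsto.const_mul _ (tendsto_finsetProd _ fun i _ => ?_)
      have h1 := fderiv_moll_tendsto (hf i) (hd i x hx) (EuclideanSpace.single (σ i) 1)
      refine h1.congr' ?_
      filter_upwards [self_mem_nhdsWithin] with ε hε
      exact (fderiv_slice (slab_diff (hW i) hε x) _).symm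
    · have h0 : ψ x = 0 := image_eq_zero_of_notMem_tsupport fun h => hx (hψs h)
      rw [h0, zero_mul]
      refine (tendsto_const_nhds (x := (0 : ℝ))).congr' ?_
      filter_upwards [self_mem_nhdsWithin] with ε hε
      rw [PsiF_zero n hε (by rw [h0, abs_zero]; exact (le_of_lt hε)), zero_mul]

lemma scalar_est (n : ℕ) (hn : 2 ≤ n) : ∃ K : ℝ, 0 < K ∧ ∀ (Ω : Set (Euc n)), IsOpen Ω →
    Bornology.IsBounded Ω → ∀ w : Fin n → Euc n → ℝ, (∀ i, ∀ x ∈ Ω, DifferentiableAt ℝ (w i) x) →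
    ∀ A : ℝ, 0 ≤ A → (∀ i, ∀ x ∈ Ω, ∀ z ∈ Ω, |w i z - w i x| ≤ A * dist z x) →
    (∀ i, gagl n Ω (w i) ≠ ⊤) → ∀ ψ : Euc n → ℝ, Cc1 n Ω ψ → (∀ x, ‖fderiv ℝ ψ x‖ ≤ 1) →
    |∫ x, ψ x * (gradMat n w x).det| ≤ K * ∏ i, (gagl n Ω (w i)).toReal ^ (1 / (n : ℝ)) := by
  obtain ⟨C, hC0, hC⟩ := fderiv_moll_bound n
  set B := volume (ball (0 : Euc n) 1) with hB
  have hBpos : 0 < B.toReal :=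
    ENNReal.toReal_pos (measure_ball_pos _ _ one_pos).ne' measure_ball_lt_top.ne
  refine ⟨((4 + n) * n.factorial * C ^ n) * B.toReal ^ (n - 1), by positivity, ?_⟩
  intro Ω hΩo hΩb w hwd A hA hwl hwg ψ hψ hL
  set f : Fin n → Euc n → ℝ := fun i => Ω.indicator (w i) with hf
  have hfe : ∀ i, ∀ x ∈ Ω, f i x = w i x := fun i x hx => Set.indicator_of_mem hx _
  have hfev : ∀ i, ∀ x ∈ Ω, f i =ᶠ[𝓝 x] w i := fun i x hx =>
    Filter.eventuallyEq_of_mem (hΩo.mem_nhds hx) (hfe i)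
  have hwc : ∀ i, ContinuousOn (w i) Ω := fun i x hx => (hwd i x hx).continuousAt.continuousWithinAt
  have hfm : ∀ i, Measurable (f i) := by
    intro i
    classical
    have := ContinuousOn.measurable_piecewise (hwc i) (g := fun _ => (0 : ℝ)) continuousOn_const
      hΩo.measurableSet
    rwa [show (fun _ : Euc n => (0 : ℝ)) = 0 from rfl, Set.piecewise_eq_indicator] at this
  have hvol : volume Ω < ⊤ := hΩb.measure_lt_top
  have hfi : ∀ i, LocallyIntegrable (f i) := by
    intro i
    refine Integrable.locallyIntegrable ?_
    rw [hf, integrable_indicator_iff hΩo.measurableSet]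
    rcases Set.eq_empty_or_nonempty Ω with h | ⟨x0, hx0⟩
    · rw [h]; exact integrableOn_empty
    obtain ⟨R, hR⟩ := hΩb.exists_norm_le
    have : IsFiniteMeasure (volume.restrict Ω) := ⟨by simpa using hvol⟩
    refine Integrable.of_bound ?_ (|w i x0| + A * (R + R)) ?_
    · exact ((hwc i).aestronglyMeasurable hΩo.measurableSet)
    · refine (ae_restrict_mem hΩo.measurableSet).mono fun z hz => ?_
      have h1 := hwl i x0 hx0 z hz
      have h2 : dist z x0 ≤ R + R :=
        (dist_le_norm_add_norm z x0).trans (add_le_add (hR z hz) (hR x0 hx0))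
      have h3 : A * dist z x0 ≤ A * (R + R) := mul_le_mul_of_nonneg_left h2 hA
      rw [Real.norm_eq_abs]
      have h4 := abs_sub_abs_le_abs_sub (w i z) (w i x0)
      linarith
  have hg : ∀ i, gagl n Ω (f i) = gagl n Ω (w i) := by
    intro i
    unfold gagl
    refine setLIntegral_congr_fun hΩo.measurableSet fun x hx => ?_
    refine setLIntegral_congr_fun hΩo.measurableSet fun z hz => ?_
    simp only [hfe i x hx, hfe i z hz]
  have hlim := limit_det n hC0 hC (Ω := Ω) hfi hA
    (fun i x hx z hz => by rw [hfe i x hx, hfe i z hz]; exact hwl i x hx z hz)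
    (fun i x hx => ((hfev i x hx).differentiableAt_iff).2 (hwd i x hx)) hψ hL
  have hintg : ∫ x, ψ x * (gradMat n f x).det = ∫ x, ψ x * (gradMat n w x).det := by
    refine integral_congr_ae (Eventually.of_forall fun x => ?_)
    by_cases hx : x ∈ Ω
    · have : gradMat n f x = gradMat n w x := by
        ext i j
        show fderiv ℝ (f i) x _ = fderiv ℝ (w i) x _
        rw [(hfev i x hx).fderiv_eq]
      simp only [this]
    · have h0 : ψ x = 0 := image_eq_zero_of_notMem_tsupport fun h => hx (hψ.2.2 h)
      simp only [h0, zero_mul]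
  rw [hintg] at hlim
  have hbd := le_of_tendsto hlim.enorm (by
    filter_upwards [self_mem_nhdsWithin] with ε hε
    exact stokes_bound n hn hC0 hC hΩo.measurableSet hfm hfi hψ hL hε)
  simp only [hg] at hbd
  have htop : ∏ i, gagl n Ω (w i) ^ (1 / (n : ℝ)) ≠ ⊤ :=
    ENNReal.prod_ne_top fun i _ => ENNReal.rpow_ne_top_of_nonneg (by positivity) (hwg i)
  have h5 := ENNReal.toReal_mono (ENNReal.mul_ne_top ENNReal.ofReal_ne_top
    (ENNReal.mul_ne_top (ENNReal.pow_ne_top measure_ball_lt_top.ne) htop)) hbd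
  rw [toReal_enorm, Real.norm_eq_abs, ENNReal.toReal_mul, ENNReal.toReal_mul, ENNReal.toReal_pow,
    ENNReal.toReal_ofReal (by positivity), ENNReal.toReal_prod, ← mul_assoc] at h5
  simpa only [ENNReal.toReal_rpow] using h5


lemma grad_bound {n : ℕ} {F : Type*} [NormedAddCommGroup F] [NormedSpace ℝ F]
    {Ω : Set (Euc n)} (hΩ : IsOpen Ω) {u : Euc n → F}
    (hu : ContDiffOn ℝ 1 u (closure Ω)) {x0 : Euc n} (hx0 : x0 ∈ closure Ω) :
    ∃ r > 0, ∃ M ≥ 0, ∀ x ∈ ball x0 r ∩ Ω, ‖fderiv ℝ u x‖ ≤ M := by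
  have h := hu x0 hx0
  rw [← zero_add (1 : WithTop ℕ∞), contDiffWithinAt_succ_iff_hasFDerivWithinAt' (by simp)] at h
  obtain ⟨U, hU, hUs, -, f', hf', hc⟩ := h
  rw [Set.insert_eq_of_mem hx0] at hU
  have hb : ∀ᶠ x in 𝓝[closure Ω] x0, ‖f' x‖ ≤ ‖f' x0‖ + 1 := by
    have := hc.continuousWithinAt.norm.tendsto.eventually (gt_mem_nhds (lt_add_one ‖f' x0‖))
    exact this.mono fun x hx => le_of_lt hx
  obtain ⟨r, hr, hr2⟩ := Metric.mem_nhdsWithin_iff.1 (Filter.inter_mem hU hb)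
  refine ⟨r, hr, ‖f' x0‖ + 1, by positivity, fun x hx => ?_⟩
  have h3 := hr2 ⟨hx.1, subset_closure hx.2⟩
  have h4 : HasFDerivAt u (f' x) x :=
    (hf' x h3.1).hasFDerivAt (Filter.mem_of_superset (hΩ.mem_nhds hx.2) subset_closure)
  rw [h4.fderiv]
  exact h3.2

lemma boundary_aux {n : ℕ} {f : Euc n → ℝ} (hf : ContDiff ℝ 1 f) {x0 : Euc n}
    (hA : fderiv ℝ f x0 ≠ 0) :
    ∃ r > 0, ∃ e : Euc n, ∃ K > 0, ∀ x ∈ ball x0 r, ∀ y, f x < 0 → ∀ σ ≥ 0, ∀ d ≥ 0, ‖y - x‖ ≤ d →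
      y + σ • e ∈ ball x0 r → (K * d ≤ σ) → f (y + σ • e) < 0 := by
  set A := fderiv ℝ f x0
  obtain ⟨v, hv⟩ : ∃ v, A v ≠ 0 := by
    by_contra! h
    exact hA (ContinuousLinearMap.ext h)
  set e : Euc n := (-(A v)⁻¹) • v with he
  have hAe : A e = -1 := by
    rw [he, map_smul, smul_eq_mul]; field_simp
  set c : ℝ := 1 / (2 * (‖e‖ + 1)) with hc
  have hcpos : 0 < c := by positivity
  have hce : c * ‖e‖ ≤ 1 / 2 := by
    rw [hc]
    rw [div_mul_eq_mul_div, one_mul, div_le_div_iff₀ (by positivity) (by norm_num)]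
    linarith
  have hc1 : c < 1 := by
    rw [hc, div_lt_one (by positivity)]
    linarith [norm_nonneg e]
  have hcont : Continuous (fderiv ℝ f) := hf.continuous_fderiv one_ne_zero
  obtain ⟨r, hr, hr2⟩ := Metric.continuousAt_iff.1 (hcont.continuousAt (x := x0)) c hcpos
  refine ⟨r, hr, e, 2 * (‖A‖ + 1), by positivity, ?_⟩
  intro x hx y hfx σ hσ d hd hyx hyb hK
  have h1 : ‖f (y + σ • e) - f x - A (y + σ • e - x)‖ ≤ c * ‖y + σ • e - x‖ :=
    Convex.norm_image_sub_le_of_norm_fderiv_le' (s := ball x0 r) (𝕜 := ℝ)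
      (fun z _ => hf.differentiable one_ne_zero z)
      (fun z hz => by rw [← dist_eq_norm]; exact (hr2 hz).le) (convex_ball _ _) hx hyb
  have e1 : y + σ • e - x = (y - x) + σ • e := by abel
  have h2 : A (y + σ • e - x) ≤ ‖A‖ * d - σ := by
    rw [e1, map_add, map_smul, hAe, smul_eq_mul]
    have := (le_abs_self _).trans (A.le_opNorm (y - x))
    have h3 : ‖A‖ * ‖y - x‖ ≤ ‖A‖ * d := by gcongr
    linarith
  have h3 : ‖y + σ • e - x‖ ≤ d + σ * ‖e‖ := by
    rw [e1]
    refine (norm_add_le _ _).trans ?_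
    rw [norm_smul, Real.norm_eq_abs, abs_of_nonneg hσ]
    linarith
  have h4 : c * ‖y + σ • e - x‖ ≤ d + σ / 2 := by
    calc _ ≤ c * (d + σ * ‖e‖) := by gcongr
      _ = c * d + σ * (c * ‖e‖) := by ring
      _ ≤ 1 * d + σ * (1 / 2) := by gcongr
      _ = _ := by ring
  have h5 := (abs_le.1 h1).2
  nlinarith

lemma lip_local {n : ℕ} {F : Type*} [NormedAddCommGroup F] [NormedSpace ℝ F]
    {Ω : Set (Euc n)} (hΩ : IsOpen Ω) (hs : SmoothBoundary n Ω) {u : Euc n → F}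
    (hu : ContDiffOn ℝ 1 u (closure Ω)) {x0 : Euc n} (hx0 : x0 ∈ closure Ω) :
    ∃ r > 0, ∃ L : NNReal, LipschitzOnWith L u (ball x0 r ∩ Ω) := by
  obtain ⟨r1, hr1, M, hM, hgb⟩ := grad_bound hΩ hu hx0
  have hdiff : ∀ x ∈ Ω, DifferentiableAt ℝ u x := fun x hx =>
    (hu.contDiffAt (Filter.mem_of_superset (hΩ.mem_nhds hx) subset_closure)).differentiableAt
      one_ne_zero
  have hseg : ∀ a b, segment ℝ a b ⊆ ball x0 r1 ∩ Ω → ‖u b - u a‖ ≤ M * ‖b - a‖ := by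
    intro a b hab
    exact Convex.norm_image_sub_le_of_norm_fderiv_le (𝕜 := ℝ) (fun x hx => hdiff x (hab hx).2)
      (fun x hx => hgb x (hab hx)) (convex_segment a b) (left_mem_segment ℝ a b)
      (right_mem_segment ℝ a b)
  by_cases hxΩ : x0 ∈ Ω
  · obtain ⟨r2, hr2, hb⟩ := Metric.isOpen_iff.1 hΩ x0 hxΩ
    refine ⟨min r1 r2, lt_min hr1 hr2, M.toNNReal, ?_⟩
    refine LipschitzOnWith.of_dist_le_mul fun x hx y hy => ?_
    rw [dist_comm, dist_comm x y, dist_eq_norm, dist_eq_norm, Real.coe_toNNReal _ hM]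
    refine hseg x y fun z hz => ?_
    have := (convex_ball x0 (min r1 r2)).segment_subset hx.1 hy.1 hz
    exact ⟨ball_subset_ball (min_le_left _ _) this,
      hb (ball_subset_ball (min_le_right _ _) this)⟩
  · obtain ⟨f, hf, hfΩ, hfr⟩ := hs
    have hfront : x0 ∈ frontier Ω := by
      rw [hΩ.frontier_eq]; exact ⟨hx0, hxΩ⟩
    obtain ⟨r2, hr2, e, K, hK, hE⟩ := boundary_aux (hf.of_le (by exact_mod_cast le_top))
      (hfr x0 hfront)
    have hmem : ∀ z, z ∈ Ω ↔ f z < 0 := fun z => by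
      rw [hfΩ]; exact Iff.rfl
    set r := min r1 r2 with hr
    have hrpos : 0 < r := lt_min hr1 hr2
    set r3 := r / (2 * (1 + 2 * K * ‖e‖)) with hr3
    have hr3pos : 0 < r3 := by positivity
    have hr3e : r3 * (1 + 2 * K * ‖e‖) < r := by
      rw [hr3]
      have : r / (2 * (1 + 2 * K * ‖e‖)) * (1 + 2 * K * ‖e‖) = r / 2 := by field_simp
      rw [this]; linarith
    refine ⟨r3, hr3pos, (M * (2 * (K * ‖e‖) + 1)).toNNReal, ?_⟩
    refine LipschitzOnWith.of_dist_le_mul fun x hx y hy => ?_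
    rw [dist_comm, dist_comm x y, dist_eq_norm, dist_eq_norm, Real.coe_toNNReal _ (by positivity)]
    set d := ‖y - x‖ with hd
    have hd2 : d ≤ 2 * r3 := by
      have h1 := mem_ball.1 hx.1
      have h2 := mem_ball.1 hy.1
      rw [hd, ← dist_eq_norm]
      linarith [dist_triangle_right y x x0]
    have hd0 : 0 ≤ d := norm_nonneg _
    have hball : ∀ z ∈ ball x0 r3, ∀ σ, 0 ≤ σ → σ ≤ K * d → z + σ • e ∈ ball x0 r := by
      intro z hz σ h0 h1
      rw [mem_ball, dist_eq_norm] at hz ⊢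
      have e1 : z + σ • e - x0 = (z - x0) + σ • e := by abel
      rw [e1]
      refine (norm_add_le _ _).trans_lt ?_
      rw [norm_smul, Real.norm_eq_abs, abs_of_nonneg h0]
      have h2 : σ * ‖e‖ ≤ (K * (2 * r3)) * ‖e‖ := by
        gcongr
        exact h1.trans (by gcongr)
      nlinarith
    have hb1 : ball x0 r ⊆ ball x0 r1 := ball_subset_ball (min_le_left _ _)
    have hb2 : ball x0 r ⊆ ball x0 r2 := ball_subset_ball (min_le_right _ _)
    have hb3 : ball x0 r3 ⊆ ball x0 r := by
      refine ball_subset_ball ?_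
      nlinarith [mul_nonneg hr3pos.le (mul_nonneg hK.le (norm_nonneg e))]
    have hvert : ∀ z ∈ ball x0 r3 ∩ Ω, ‖u (z + (K * d) • e) - u z‖ ≤ M * (K * d * ‖e‖) := by
      intro z hz
      have := hseg z (z + (K * d) • e) (by
        intro p hp
        rw [segment_eq_image'] at hp
        obtain ⟨θ, hθ, rfl⟩ := hp
        have e2 : z + θ • (z + (K * d) • e - z) = z + (θ * (K * d)) • e := by
          rw [add_sub_cancel_left, smul_smul]
        simp only [e2]
        have hσ0 : 0 ≤ θ * (K * d) := mul_nonneg hθ.1 (by positivity)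
        have hin := hball z hz.1 (θ * (K * d)) hσ0
          (mul_le_of_le_one_left (by positivity) hθ.2)
        refine ⟨hb1 hin, (hmem _).2 ?_⟩
        refine hE z (hb2 (hb3 hz.1)) z ((hmem z).1 hz.2) _ hσ0 0 le_rfl (by simp) (hb2 hin) ?_
        simpa using hσ0)
      rw [add_sub_cancel_left, norm_smul, Real.norm_eq_abs, abs_of_nonneg (by positivity)] at this
      exact this
    have hhor : ‖u (y + (K * d) • e) - u (x + (K * d) • e)‖ ≤ M * d := by
      have := hseg (x + (K * d) • e) (y + (K * d) • e) (by
        intro p hp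
        rw [segment_eq_image'] at hp
        obtain ⟨θ, hθ, rfl⟩ := hp
        have e2 : x + (K * d) • e + θ • (y + (K * d) • e - (x + (K * d) • e)) =
            (x + θ • (y - x)) + (K * d) • e := by
          rw [add_sub_add_right_eq_sub]; abel
        simp only [e2]
        have hz : x + θ • (y - x) ∈ ball x0 r3 := by
          refine (convex_ball x0 r3).segment_subset hx.1 hy.1 ?_
          rw [segment_eq_image']
          exact ⟨θ, hθ, rfl⟩
        have hin := hball _ hz (K * d) (by positivity) le_rfl
        refine ⟨hb1 hin, (hmem _).2 ?_⟩
        refine hE x (hb2 (hb3 hx.1)) _ ((hmem x).1 hx.2) _ (by positivity) d hd0 ?_ (hb2 hin) le_rfl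
        rw [add_sub_cancel_left, norm_smul, Real.norm_eq_abs, abs_of_nonneg hθ.1]
        exact mul_le_of_le_one_left hd0 hθ.2)
      rw [add_sub_add_right_eq_sub] at this
      exact this
    have e3 : u y - u x = (u (x + (K * d) • e) - u x) + (u (y + (K * d) • e) - u (x + (K * d) • e))
        - (u (y + (K * d) • e) - u y) := by abel
    rw [e3]
    refine (norm_sub_le _ _).trans ?_
    have h7 := norm_add_le (u (x + (K * d) • e) - u x)
      (u (y + (K * d) • e) - u (x + (K * d) • e))
    have h8 := hvert x hx
    have h9 := hvert y hy
    calc _ ≤ M * (K * d * ‖e‖) + M * d + M * (K * d * ‖e‖) := by linarith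
      _ = _ := by ring

lemma lip_global {n : ℕ} {F : Type*} [NormedAddCommGroup F] [NormedSpace ℝ F]
    {Ω : Set (Euc n)} (hΩ : IsOpen Ω) (hb : Bornology.IsBounded Ω) (hs : SmoothBoundary n Ω)
    {u : Euc n → F} (hu : ContDiffOn ℝ 1 u (closure Ω)) :
    ∃ L : NNReal, LipschitzOnWith L u Ω := by
  have hc : IsCompact (closure Ω) := hb.isCompact_closure
  have : LocallyLipschitzOn (closure Ω) u := by
    intro x0 hx0
    obtain ⟨r, hr, L, hL⟩ := lip_local hΩ hs hu hx0
    refine ⟨L, closure (ball x0 r ∩ Ω), ?_, hL.closure ?_⟩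
    · refine Filter.mem_of_superset
        (inter_mem_nhdsWithin (closure Ω) (ball_mem_nhds x0 hr)) fun z hz => ?_
      exact isOpen_ball.inter_closure ⟨hz.2, hz.1⟩
    · exact hu.continuousOn.mono (closure_mono Set.inter_subset_right)
  obtain ⟨L, hL⟩ := this.exists_lipschitzOnWith_of_compact hc
  exact ⟨L, hL.mono subset_closure⟩


/-- Vector valued Gagliardo energy as a lower Lebesgue integral. -/
def gaglV (n : ℕ) (Ω : Set (Euc n)) (u : Euc n → Euc n) : ENNReal :=
  ∫⁻ x in Ω, ∫⁻ z in Ω, ENNReal.ofReal (‖u x - u z‖ ^ n / dist x z ^ (2 * n - 1))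

lemma riesz_finite (n : ℕ) (hn : 2 ≤ n) (R : ℝ) :
    ∫⁻ y in ball (0 : Euc n) R, ENNReal.ofReal ((‖y‖ ^ (n - 1))⁻¹) < ⊤ := by
  have h := integrableOn_ball_of_norm_le_rpow (E := Euc n) (F := ℝ) (μ := volume)
    (f := fun y => (‖y‖ ^ (n - 1))⁻¹) (C := 1) (α := ((n - 1 : ℕ) : ℝ)) (r := R)
    (by rw [finrank_euclideanSpace_fin]; omega)
    (by rw [finrank_euclideanSpace_fin]; exact_mod_cast (by omega : n - 1 < n))
    (Eventually.of_forall fun y => by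
      rw [Real.rpow_neg (norm_nonneg _), Real.rpow_natCast, one_mul, Real.norm_eq_abs,
        abs_of_nonneg (by positivity)])
    (by fun_prop)
  have h2 := h.2
  rw [hasFiniteIntegral_iff_ofReal (Eventually.of_forall fun y => by positivity)] at h2
  exact h2

lemma gaglV_inner (n : ℕ) (hn : 2 ≤ n) {Ω : Set (Euc n)} (hΩ : MeasurableSet Ω)
    {R : ℝ} {u : Euc n → Euc n} {L : ℝ} (hL0 : 0 ≤ L) {x : Euc n}
    (hR : ∀ z ∈ Ω, dist z x < R)
    (hL : ∀ z ∈ Ω, ‖u x - u z‖ ≤ L * dist x z) :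
    ∫⁻ z in Ω, ENNReal.ofReal (‖u x - u z‖ ^ n / dist x z ^ (2 * n - 1)) ≤
      ENNReal.ofReal (L ^ n) * ∫⁻ y in ball (0 : Euc n) R, ENNReal.ofReal ((‖y‖ ^ (n - 1))⁻¹) := by
  rw [← lintegral_const_mul' _ _ ENNReal.ofReal_ne_top, ← lintegral_indicator measurableSet_ball,
    ← lintegral_indicator hΩ]
  refine le_trans ?_ (le_of_eq (lintegral_sub_right_eq_self (μ := volume)
    ((ball (0 : Euc n) R).indicator fun y =>
      ENNReal.ofReal (L ^ n) * ENNReal.ofReal ((‖y‖ ^ (n - 1))⁻¹)) x))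
  refine lintegral_mono fun z => ?_
  by_cases hz : z ∈ Ω
  · have hb : z - x ∈ ball (0 : Euc n) R := by
      rw [mem_ball_zero_iff, ← dist_eq_norm]; exact hR z hz
    rw [Set.indicator_of_mem hz, Set.indicator_of_mem hb,
      ← ENNReal.ofReal_mul (by positivity)]
    apply ENNReal.ofReal_le_ofReal
    rw [← dist_eq_norm z x, dist_comm z x]
    have h1 : ‖u x - u z‖ ^ n ≤ (L * dist x z) ^ n :=
      pow_le_pow_left₀ (norm_nonneg _) (hL z hz) n
    rcases eq_or_ne x z with rfl | hxz
    · simp [show n ≠ 0 by omega]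
      positivity
    have hd : 0 < dist x z := dist_pos.2 hxz
    rw [div_le_iff₀ (by positivity)]
    refine h1.trans (le_of_eq ?_)
    have e : 2 * n - 1 = n + (n - 1) := by omega
    rw [e, pow_add, mul_pow]
    field_simp
  · rw [Set.indicator_of_notMem hz]; exact zero_le

lemma exponent_eq (n : ℕ) (hn : 2 ≤ n) :
    (n : ℝ) + ((n : ℝ) - 1) / n * n = ((2 * n - 1 : ℕ) : ℝ) := by
  have h : (n : ℝ) ≠ 0 := by
    have : (2 : ℝ) ≤ n := by exact_mod_cast hn
    linarith
  rw [div_mul_cancel₀ _ h, Nat.cast_sub (by omega)]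
  push_cast; ring

lemma gaglV_finite (n : ℕ) (hn : 2 ≤ n) {Ω : Set (Euc n)} (hΩo : IsOpen Ω)
    (hΩb : Bornology.IsBounded Ω) {u : Euc n → Euc n} {L : NNReal} (hL : LipschitzOnWith L u Ω) :
    ∃ N : ENNReal, N < ⊤ ∧ (∀ x ∈ Ω,
      ∫⁻ z in Ω, ENNReal.ofReal (‖u x - u z‖ ^ n / dist x z ^ (2 * n - 1)) ≤ N) := by
  obtain ⟨R, hR⟩ := hΩb.exists_norm_le
  refine ⟨_, ENNReal.mul_lt_top ENNReal.ofReal_lt_top (riesz_finite n hn (R + R + 1)), fun x hx =>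
    gaglV_inner n hn hΩo.measurableSet L.2 (fun z hz => ?_) (fun z hz => ?_)⟩
  · linarith [dist_le_norm_add_norm z x, hR z hz, hR x hx]
  · rw [← dist_eq_norm]; exact hL.dist_le_mul x hx z hz

lemma gaglV_ne_top (n : ℕ) (hn : 2 ≤ n) {Ω : Set (Euc n)} (hΩo : IsOpen Ω)
    (hΩb : Bornology.IsBounded Ω) {u : Euc n → Euc n} {L : NNReal} (hL : LipschitzOnWith L u Ω) :
    gaglV n Ω u ≠ ⊤ := by
  obtain ⟨N, hN, h⟩ := gaglV_finite n hn hΩo hΩb hL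
  refine ne_of_lt ?_
  unfold gaglV
  refine (setLIntegral_mono' hΩo.measurableSet h).trans_lt ?_
  rw [setLIntegral_const]
  exact ENNReal.mul_lt_top hN hΩb.measure_lt_top

lemma sobSemi_eq (n : ℕ) (hn : 2 ≤ n) {Ω : Set (Euc n)} (hΩo : IsOpen Ω)
    (hΩb : Bornology.IsBounded Ω) {u : Euc n → Euc n} {L : NNReal} (hL : LipschitzOnWith L u Ω) :
    sobSemi n (((n : ℝ) - 1) / n) n Ω u = (gaglV n Ω u).toReal ^ (1 / (n : ℝ)) := by
  obtain ⟨N, hN, h⟩ := gaglV_finite n hn hΩo hΩb hL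
  unfold sobSemi
  congr 1
  rw [exponent_eq n hn]
  simp only [Real.rpow_natCast]
  have hm := hΩo.measurableSet
  set u' : Euc n → Euc n := Ω.indicator u with hu'
  have hue : ∀ x ∈ Ω, u' x = u x := fun x hx => Set.indicator_of_mem hx _
  have hum : Measurable u' := by
    classical
    have := ContinuousOn.measurable_piecewise hL.continuousOn
      (g := fun _ => (0 : Euc n)) continuousOn_const hm
    rwa [show (fun _ : Euc n => (0 : Euc n)) = 0 from rfl, Set.piecewise_eq_indicator] at this
  have hkm : Measurable (fun q : Euc n × Euc n =>
      ‖u' q.1 - u' q.2‖ ^ n / dist q.1 q.2 ^ (2 * n - 1)) := by fun_prop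
  set Φ : Euc n → ENNReal := fun x =>
    ∫⁻ z in Ω, ENNReal.ofReal (‖u' x - u' z‖ ^ n / dist x z ^ (2 * n - 1)) with hΦ
  have hΦe : ∀ x ∈ Ω, Φ x =
      ∫⁻ z in Ω, ENNReal.ofReal (‖u x - u z‖ ^ n / dist x z ^ (2 * n - 1)) := fun x hx =>
    setLIntegral_congr_fun hm fun z hz => by simp only [hue x hx, hue z hz]
  have hin : ∀ x ∈ Ω, ∫ y in Ω, ‖u x - u y‖ ^ n / dist x y ^ (2 * n - 1) = (Φ x).toReal := by
    intro x hx
    rw [← setIntegral_congr_fun (f := fun y => ‖u' x - u' y‖ ^ n / dist x y ^ (2 * n - 1)) hm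
      (fun z hz => by simp only [hue x hx, hue z hz])]
    rw [integral_eq_lintegral_of_nonneg_ae (Eventually.of_forall fun z => by positivity)]
    have : Measurable fun y => ‖u' x - u' y‖ ^ n / dist x y ^ (2 * n - 1) := by fun_prop
    exact this.aestronglyMeasurable
  rw [setIntegral_congr_fun hm hin, integral_toReal]
  · congr 1
    exact setLIntegral_congr_fun hm hΦe
  · exact (hkm.ennreal_ofReal.lintegral_prod_right').aemeasurable
  · refine (ae_restrict_mem hm).mono fun x hx => ?_
    rw [hΦe x hx]
    exact (h x hx).trans_lt hN

lemma gagl_comp_le (n : ℕ) (Ω : Set (Euc n)) (u : Euc n → Euc n) (i : Fin n) :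
    gagl n Ω (fun x => u x i) ≤ gaglV n Ω u := by
  refine lintegral_mono fun x => lintegral_mono fun z => ENNReal.ofReal_le_ofReal ?_
  have : ‖u x i - u z i‖ ≤ ‖u x - u z‖ := PiLp.norm_apply_le (u x - u z) i
  gcongr

lemma sobSemi_le_norm (n : ℕ) (s : ℝ) (Ω : Set (Euc n)) (u : Euc n → Euc n) :
    sobSemi n s n Ω u ≤ sobNorm n s n Ω u := by
  unfold sobNorm
  have : 0 ≤ (∫ x in Ω, ‖u x‖ ^ (n : ℝ)) ^ (1 / (n : ℝ)) :=
    Real.rpow_nonneg (integral_nonneg fun x => by positivity) _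
  linarith

lemma comp_le_norm (n : ℕ) (hn : 2 ≤ n) {Ω : Set (Euc n)} (hΩo : IsOpen Ω)
    (hΩb : Bornology.IsBounded Ω) {u : Euc n → Euc n} {L : NNReal} (hL : LipschitzOnWith L u Ω)
    (i : Fin n) :
    (gagl n Ω (fun x => u x i)).toReal ^ (1 / (n : ℝ)) ≤
      sobNorm n (((n : ℝ) - 1) / n) n Ω u := by
  refine le_trans ?_ (sobSemi_le_norm n _ Ω u)
  rw [sobSemi_eq n hn hΩo hΩb hL]
  refine Real.rpow_le_rpow ENNReal.toReal_nonneg ?_ (by positivity)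
  exact ENNReal.toReal_mono (gaglV_ne_top n hn hΩo hΩb hL) (gagl_comp_le n Ω u i)

lemma det_tele {n : ℕ} (A B : Matrix (Fin n) (Fin n) ℝ) :
    A.det - B.det = ∑ k ∈ Finset.range n, (Matrix.of fun i j : Fin n => if i.val < k then A i j
      else if i.val = k then A i j - B i j else B i j).det := by
  set Z : ℕ → Matrix (Fin n) (Fin n) ℝ := fun k =>
    Matrix.of fun i j : Fin n => if i.val < k then A i j else B i j with hZ
  have h0 : Z 0 = B := by ext i j; simp [hZ]
  have hn : Z n = A := by ext i j; simp [hZ]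
  have hs : A.det - B.det = ∑ k ∈ Finset.range n, ((Z (k + 1)).det - (Z k).det) := by
    rw [Finset.sum_range_sub (fun k => (Z k).det), h0, hn]
  rw [hs]
  refine Finset.sum_congr rfl fun k hk => ?_
  rw [Finset.mem_range] at hk
  set kk : Fin n := ⟨k, hk⟩ with hkk
  have hval : ∀ i : Fin n, i ≠ kk → i.val ≠ k := fun i hi h => hi (Fin.ext h)
  have e1 : Z (k + 1) = (Z k).updateRow kk ((A kk - B kk) + B kk) := by
    ext i j
    rcases eq_or_ne i kk with rfl | hi
    · simp [hZ, kk]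
    · rw [Matrix.updateRow_ne hi]
      have := hval i hi
      simp only [hZ, Matrix.of_apply]
      by_cases h : i.val < k
      · rw [if_pos h, if_pos (by omega)]
      · rw [if_neg h, if_neg (by omega)]
  have e2 : Z k = (Z k).updateRow kk (B kk) := by
    ext i j
    rcases eq_or_ne i kk with rfl | hi
    · simp [hZ, kk]
    · rw [Matrix.updateRow_ne hi]
  have e3 : (Matrix.of fun i j : Fin n => if i.val < k then A i j
      else if i.val = k then A i j - B i j else B i j) = (Z k).updateRow kk (A kk - B kk) := by
    ext i j
    rcases eq_or_ne i kk with rfl | hi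
    · simp [kk]
    · rw [Matrix.updateRow_ne hi]
      simp [hZ, hval i hi]
  rw [e1, Matrix.det_updateRow_add, ← e2, e3]
  ring

lemma integrable_det {n : ℕ} {Ω : Set (Euc n)} (hΩo : IsOpen Ω) {w : Fin n → Euc n → ℝ}
    (hw : ∀ i, ContDiffOn ℝ 1 (w i) Ω) {ψ : Euc n → ℝ} (hψ : Cc1 n Ω ψ) :
    Integrable (fun x => ψ x * (gradMat n w x).det) := by
  rw [← integrableOn_iff_integrable_of_support_subset (s := tsupport ψ)]
  · refine ContinuousOn.integrableOn_compact hψ.2.1 ?_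
    refine hψ.1.continuous.continuousOn.mul (ContinuousOn.mono ?_ hψ.2.2)
    simp only [det_rows]
    refine continuousOn_finsetSum _ fun σ _ => continuousOn_const.mul
      (continuousOn_finsetProd _ fun i _ => ?_)
    exact ((hw i).continuousOn_fderiv_of_isOpen hΩo le_rfl).clm_apply continuousOn_const
  · intro x hx
    apply subset_tsupport
    intro h0
    apply hx
    simp only [h0, zero_mul]



lemma sobNorm_nonneg_aux (n : ℕ) (s : ℝ) (Ω : Set (Euc n)) (u : Euc n → Euc n) :
    0 ≤ sobNorm n s n Ω u := by
  unfold sobNorm sobSemi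
  refine add_nonneg (Real.rpow_nonneg (integral_nonneg fun x => by positivity) _)
    (Real.rpow_nonneg (integral_nonneg fun x => integral_nonneg fun y => by positivity) _)

lemma gradMat_comp {n : ℕ} {u : Euc n → Euc n} {x : Euc n} (hu : DifferentiableAt ℝ u x)
    (i j : Fin n) : fderiv ℝ (fun y => u y i) x (EuclideanSpace.single j 1) = jacMat n u x i j := by
  have h := ((EuclideanSpace.proj (𝕜 := ℝ) i).hasFDerivAt (x := u x)).comp x hu.hasFDerivAt
  have h2 : HasFDerivAt (fun y => u y i) ((EuclideanSpace.proj (𝕜 := ℝ) i).comp (fderiv ℝ u x)) x := h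
  rw [h2.fderiv]
  rfl

/-- The mixed family of components used in the telescoping. -/
def mixed (n : ℕ) (u v : Euc n → Euc n) (k : ℕ) (i : Fin n) : Euc n → ℝ :=
  if i.val < k then (fun x => u x i) else if i.val = k then (fun x => (u - v) x i)
    else (fun x => v x i)

lemma mixed_ind {n : ℕ} {u v : Euc n → Euc n} (P : (Euc n → ℝ) → Prop) (i : Fin n)
    (hu : P (fun x => u x i)) (hd : P (fun x => (u - v) x i)) (hv : P (fun x => v x i)) (k : ℕ) :
    P (mixed n u v k i) := by
  unfold mixed
  split_ifs
  · exact hu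
  · exact hd
  · exact hv

lemma comp_contDiffOn {n : ℕ} {u : Euc n → Euc n} {s : Set (Euc n)} (hu : ContDiffOn ℝ 1 u s)
    (i : Fin n) : ContDiffOn ℝ 1 (fun x => u x i) s :=
  (EuclideanSpace.proj (𝕜 := ℝ) i).contDiff.comp_contDiffOn hu

lemma comp_lip {n : ℕ} {u : Euc n → Euc n} {s : Set (Euc n)} {L : NNReal} {A : ℝ}
    (hu : LipschitzOnWith L u s) (hA : (L : ℝ) ≤ A) (i : Fin n) :
    ∀ x ∈ s, ∀ z ∈ s, |u z i - u x i| ≤ A * dist z x := by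
  intro x hx z hz
  have h1 : ‖u z i - u x i‖ ≤ ‖u z - u x‖ := PiLp.norm_apply_le (u z - u x) i
  have h2 := hu.dist_le_mul z hz x hx
  rw [dist_eq_norm] at h2
  rw [← Real.norm_eq_abs]
  exact h1.trans (h2.trans (mul_le_mul_of_nonneg_right hA dist_nonneg))

lemma mixed_prod_le {n : ℕ} {k : ℕ} (hk : k < n) {f : Fin n → ℝ} {D U V : ℝ}
    (hf : ∀ i, 0 ≤ f i) (hU0 : 0 ≤ U) (hV0 : 0 ≤ V) (hD0 : 0 ≤ D)
    (h1 : ∀ i : Fin n, i.val < k → f i ≤ U) (h2 : ∀ i : Fin n, i.val = k → f i ≤ D)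
    (h3 : ∀ i : Fin n, k < i.val → f i ≤ V) :
    ∏ i, f i ≤ D * (U + V) ^ (n - 1) := by
  rw [← Finset.mul_prod_erase Finset.univ f (Finset.mem_univ (⟨k, hk⟩ : Fin n))]
  refine mul_le_mul (h2 _ rfl) ?_ (Finset.prod_nonneg fun i _ => hf i) hD0
  have hc : (Finset.univ.erase (⟨k, hk⟩ : Fin n)).card = n - 1 := by
    rw [Finset.card_erase_of_mem (Finset.mem_univ _), Finset.card_univ, Fintype.card_fin]
  rw [← hc, ← Finset.prod_const]
  refine Finset.prod_le_prod (fun i _ => hf i) fun i hi => ?_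
  have hne : i.val ≠ k := fun h => (Finset.ne_of_mem_erase hi) (Fin.ext h)
  rcases lt_or_gt_of_ne hne with h | h
  · linarith [h1 i h]
  · linarith [h3 i h]

lemma mixed_est (n : ℕ) (hn : 2 ≤ n) : ∃ K : ℝ, 0 < K ∧ ∀ (Ω : Set (Euc n)), IsOpen Ω →
    Bornology.IsBounded Ω → SmoothBoundary n Ω → ∀ (u v : Euc n → Euc n) (ψ : Euc n → ℝ),
    ContDiffOn ℝ 1 u (closure Ω) → ContDiffOn ℝ 1 v (closure Ω) → Cc1 n Ω ψ →
    (∀ x, ‖fderiv ℝ ψ x‖ ≤ 1) →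
      |(∫ x in Ω, (jacMat n u x).det * ψ x) - ∫ x in Ω, (jacMat n v x).det * ψ x| ≤
        K * (sobNorm n (((n : ℝ) - 1) / n) n Ω (u - v) *
          (sobNorm n (((n : ℝ) - 1) / n) n Ω u +
            sobNorm n (((n : ℝ) - 1) / n) n Ω v) ^ (n - 1)) := by
  obtain ⟨K, hK, hest⟩ := scalar_est n hn
  have hn0 : (0 : ℝ) < n := by exact_mod_cast (by omega : 0 < n)
  refine ⟨n * K, by positivity, fun Ω hΩo hΩb hΩs u v ψ hu hv hψ hψ1 => ?_⟩
  obtain ⟨Lu, hLu⟩ := lip_global hΩo hΩb hΩs hu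
  obtain ⟨Lv, hLv⟩ := lip_global hΩo hΩb hΩs hv
  obtain ⟨Ld, hLd⟩ := lip_global hΩo hΩb hΩs (hu.sub hv : ContDiffOn ℝ 1 (u - v) (closure Ω))
  have hd := (hu.sub hv : ContDiffOn ℝ 1 (u - v) (closure Ω))
  have hu' := hu.mono subset_closure
  have hv' := hv.mono subset_closure
  have hd' := hd.mono subset_closure
  set D := sobNorm n (((n : ℝ) - 1) / n) n Ω (u - v) with hD
  set U := sobNorm n (((n : ℝ) - 1) / n) n Ω u with hU
  set V := sobNorm n (((n : ℝ) - 1) / n) n Ω v with hV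
  have dat : ∀ {g : Euc n → Euc n}, ContDiffOn ℝ 1 g Ω → ∀ x ∈ Ω, DifferentiableAt ℝ g x :=
    fun hg x hx => (hg.contDiffAt (hΩo.mem_nhds hx)).differentiableAt one_ne_zero
  have hmc : ∀ k i, ContDiffOn ℝ 1 (mixed n u v k i) Ω := fun k i =>
    mixed_ind (fun g => ContDiffOn ℝ 1 g Ω) i (comp_contDiffOn hu' i) (comp_contDiffOn hd' i)
      (comp_contDiffOn hv' i) k
  have hψ0 : ∀ x, x ∉ Ω → ψ x = 0 := fun x hx =>
    image_eq_zero_of_notMem_tsupport fun h => hx (hψ.2.2 h)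
  -- the telescoped integrals
  have hsingle : ∀ k < n, |∫ x, ψ x * (gradMat n (mixed n u v k) x).det| ≤
      K * (D * (U + V) ^ (n - 1)) := by
    intro k hk
    have hA : (0 : ℝ) ≤ Lu + Lv + Ld := by positivity
    have h := hest Ω hΩo hΩb (mixed n u v k)
      (fun i x hx => ((hmc k i).contDiffAt (hΩo.mem_nhds hx)).differentiableAt one_ne_zero)
      (Lu + Lv + Ld) hA
      (fun i => mixed_ind (fun g => ∀ x ∈ Ω, ∀ z ∈ Ω, |g z - g x| ≤ (Lu + Lv + Ld : ℝ) * dist z x) i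
        (comp_lip hLu (by linarith [Lv.2, Ld.2]) i)
        (comp_lip hLd (by linarith [Lv.2, Lu.2]) i) (comp_lip hLv (by linarith [Lu.2, Ld.2]) i) k)
      (fun i => mixed_ind (fun g => gagl n Ω g ≠ ⊤) i
        (ne_top_of_le_ne_top (gaglV_ne_top n hn hΩo hΩb hLu) (gagl_comp_le n Ω u i))
        (ne_top_of_le_ne_top (gaglV_ne_top n hn hΩo hΩb hLd) (gagl_comp_le n Ω (u - v) i))
        (ne_top_of_le_ne_top (gaglV_ne_top n hn hΩo hΩb hLv) (gagl_comp_le n Ω v i)) k)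
      ψ hψ hψ1
    refine h.trans (mul_le_mul_of_nonneg_left ?_ hK.le)
    refine mixed_prod_le hk (fun i => Real.rpow_nonneg ENNReal.toReal_nonneg _)
      (sobNorm_nonneg_aux n _ Ω u) (sobNorm_nonneg_aux n _ Ω v) (sobNorm_nonneg_aux n _ Ω (u - v))
      (fun i hi => ?_) (fun i hi => ?_) (fun i hi => ?_)
    · rw [show mixed n u v k i = fun x => u x i from if_pos hi]
      exact comp_le_norm n hn hΩo hΩb hLu i
    · rw [show mixed n u v k i = fun x => (u - v) x i by
        unfold mixed; rw [if_neg (by omega), if_pos hi]]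
      exact comp_le_norm n hn hΩo hΩb hLd i
    · rw [show mixed n u v k i = fun x => v x i by
        unfold mixed; rw [if_neg (by omega), if_neg (by omega)]]
      exact comp_le_norm n hn hΩo hΩb hLv i
  have hgm : ∀ {g : Euc n → Euc n}, ContDiffOn ℝ 1 g Ω → ∀ x ∈ Ω,
      gradMat n (fun i y => g y i) x = jacMat n g x := by
    intro g hg x hx
    ext i j
    exact gradMat_comp (dat hg x hx) i j
  have hintg : ∀ {g : Euc n → Euc n}, ContDiffOn ℝ 1 g Ω →
      ∫ x in Ω, (jacMat n g x).det * ψ x = ∫ x, ψ x * (gradMat n (fun i y => g y i) x).det := by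
    intro g hg
    rw [← setIntegral_eq_integral_of_forall_compl_eq_zero (s := Ω)
      (f := fun x => ψ x * (gradMat n (fun i y => g y i) x).det) (fun x hx => by rw [hψ0 x hx, zero_mul])]
    refine setIntegral_congr_fun hΩo.measurableSet fun x hx => ?_
    simp only [hgm hg x hx]
    ring
  have hid : ∀ {g : Euc n → Euc n}, ContDiffOn ℝ 1 g Ω →
      Integrable (fun x => ψ x * (gradMat n (fun i y => g y i) x).det) := fun hg =>
    integrable_det hΩo (fun i => comp_contDiffOn hg i) hψ
  have htele : (∫ x in Ω, (jacMat n u x).det * ψ x) - ∫ x in Ω, (jacMat n v x).det * ψ x =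
      ∑ k ∈ Finset.range n, ∫ x, ψ x * (gradMat n (mixed n u v k) x).det := by
    rw [hintg hu', hintg hv', ← integral_sub (hid hu') (hid hv'),
      ← integral_finsetSum _ (fun k _ => integrable_det hΩo (hmc k) hψ)]
    refine integral_congr_ae (Eventually.of_forall fun x => ?_)
    show _ - _ = ∑ k ∈ Finset.range n, ψ x * (gradMat n (mixed n u v k) x).det
    by_cases hx : x ∈ Ω
    · rw [← mul_sub, ← Finset.mul_sum, det_tele, hgm hu' x hx, hgm hv' x hx]
      congr 1
      refine Finset.sum_congr rfl fun k _ => ?_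
      congr 1
      ext i j
      show _ = fderiv ℝ (mixed n u v k i) x (EuclideanSpace.single j 1)
      unfold mixed
      simp only [Matrix.of_apply]
      split_ifs
      · exact (gradMat_comp (dat hu' x hx) i j).symm
      · rw [gradMat_comp (u := u - v) (dat hd' x hx) i j]
        show _ = fderiv ℝ (u - v) x (EuclideanSpace.single j 1) i
        rw [fderiv_sub (dat hu' x hx) (dat hv' x hx)]
        rfl
      · exact (gradMat_comp (dat hv' x hx) i j).symm
    · simp [hψ0 x hx]
  rw [htele]
  refine (Finset.abs_sum_le_sum_abs _ _).trans ?_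
  refine (Finset.sum_le_sum fun k hk => hsingle k (Finset.mem_range.1 hk)).trans (le_of_eq ?_)
  rw [Finset.sum_const, Finset.card_range, nsmul_eq_mul, mul_assoc]

lemma cc1_scale {n : ℕ} {Ω : Set (Euc n)} {ψ : Euc n → ℝ} (hψ : Cc1 n Ω ψ) (c : ℝ) :
    Cc1 n Ω (fun x => c * ψ x) := by
  refine ⟨contDiff_const.mul hψ.1, hψ.2.1.mul_left, (tsupport_mul_subset_right).trans hψ.2.2⟩

lemma fderiv_le_sup {n : ℕ} {Ω : Set (Euc n)} {ψ : Euc n → ℝ} (hψ : Cc1 n Ω ψ) (x : Euc n) :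
    ‖fderiv ℝ ψ x‖ ≤ sSup {r | ∃ x ∈ Ω, r = ‖fderiv ℝ ψ x‖} := by
  by_cases hx : x ∈ Ω
  · refine le_csSup ?_ ⟨x, hx, rfl⟩
    have hc : Continuous (fderiv ℝ ψ) := hψ.1.continuous_fderiv one_ne_zero
    obtain ⟨M, hM⟩ := (hψ.2.1.fderiv (𝕜 := ℝ)).exists_bound_of_continuous hc
    refine ⟨M, ?_⟩
    rintro r ⟨y, -, rfl⟩
    exact hM y
  · have : fderiv ℝ ψ x = 0 :=
      image_eq_zero_of_notMem_tsupport fun h => hx (hψ.2.2 (tsupport_fderiv_subset ℝ h))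
    rw [this, norm_zero]
    exact Real.sSup_nonneg (by rintro r ⟨y, -, rfl⟩; exact norm_nonneg _)

/-- The basic `W^{(n-1)/n,n}` estimate for distributional Jacobians. -/
theorem jacobian_estimate_W_n_minus_one_over_n
    (n : ℕ) (hn : 2 ≤ n) (Ω : Set (Euc n)) (hΩo : IsOpen Ω)
    (hΩb : Bornology.IsBounded Ω) (hΩs : SmoothBoundary n Ω) :
    ∃ C : ℝ, 0 < C ∧ ∀ (u v : Euc n → Euc n) (ψ : Euc n → ℝ),
      ContDiffOn ℝ 1 u (closure Ω) → ContDiffOn ℝ 1 v (closure Ω) → Cc1 n Ω ψ →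
      |(∫ x in Ω, (jacMat n u x).det * ψ x) - ∫ x in Ω, (jacMat n v x).det * ψ x| ≤
        C * sobNorm n (((n : ℝ) - 1) / n) n Ω (u - v) *
          (sobNorm n (((n : ℝ) - 1) / n) n Ω u + sobNorm n (((n : ℝ) - 1) / n) n Ω v) ^ (n - 1) *
          sSup {r | ∃ x ∈ Ω, r = ‖fderiv ℝ ψ x‖} := by
  obtain ⟨K, hK, hest⟩ := mixed_est n hn
  refine ⟨K, hK, fun u v ψ hu hv hψ => ?_⟩
  set S := sSup {r | ∃ x ∈ Ω, r = ‖fderiv ℝ ψ x‖} with hS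
  set D := sobNorm n (((n : ℝ) - 1) / n) n Ω (u - v) with hD
  set T := (sobNorm n (((n : ℝ) - 1) / n) n Ω u + sobNorm n (((n : ℝ) - 1) / n) n Ω v) ^ (n - 1)
    with hT
  have hS0 : 0 ≤ S := (norm_nonneg _).trans (fderiv_le_sup hψ 0)
  have key : ∀ ε : ℝ, 0 < ε →
      |(∫ x in Ω, (jacMat n u x).det * ψ x) - ∫ x in Ω, (jacMat n v x).det * ψ x| ≤
        K * D * T * (S + ε) := by
    intro ε hε
    have hp : 0 < S + ε := by linarith
    have h := hest Ω hΩo hΩb hΩs u v (fun x => (S + ε)⁻¹ * ψ x) hu hv (cc1_scale hψ _)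
      (fun x => by
        rw [fderiv_const_mul (hψ.1.differentiable one_ne_zero x), norm_smul, Real.norm_eq_abs,
          abs_of_pos (inv_pos.2 hp), inv_mul_le_iff₀ hp, mul_one]
        linarith [fderiv_le_sup hψ x])
    have e : ∀ g : Euc n → Euc n, ∫ x in Ω, (jacMat n g x).det * ((S + ε)⁻¹ * ψ x) =
        (S + ε)⁻¹ * ∫ x in Ω, (jacMat n g x).det * ψ x := by
      intro g
      rw [← integral_const_mul]
      refine integral_congr_ae (Eventually.of_forall fun x => ?_)
      show _ * (_ * _) = _ * (_ * _)
      ring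
    rw [e, e, ← mul_sub, abs_mul, abs_of_pos (inv_pos.2 hp), inv_mul_le_iff₀ hp] at h
    refine h.trans (le_of_eq ?_)
    ring
  have hlim : Tendsto (fun ε : ℝ => K * D * T * (S + ε)) (𝓝[>] 0) (𝓝 (K * D * T * S)) := by
    have hc : Continuous fun ε : ℝ => K * D * T * (S + ε) := by fun_prop
    have h0 := hc.tendsto 0
    rw [add_zero] at h0
    exact h0.mono_left nhdsWithin_le_nhds
  exact ge_of_tendsto hlim (eventually_nhdsWithin_of_forall fun ε hε => key ε hε)

end
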